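/- arXiv:1702.01338 — 4 statements merged into one kernel-verified Lean document; each statement's English description precedes it below -/
import Mathlib

section
/- Let (W,S) be a Coxeter system with Coxeter matrix m, and let x = s_1 s_2 ⋯ s_k be a nonempty word over the alphabet S. Then x is the unique reduced word of an element of the subregular set C if and only if both of the following hold: (i) s_i ≠ s_{i+1} for all 1 ≤ i ≤ k−1; and (ii) every dihedral segment of x, written in the form (s,t)_l for distinct s,t ∈ S, satisfies l < m(s,t). -/
/-!
Common definitions: alternating words, glued products, dihedral segment
decompositions, unique reduced words, and the subregular set `C`.
-/

/-- The alternating word `(s,t)_l = s t s ⋯` of length `l` beginning with `s`. -/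
def altWord {B : Type*} (s t : B) : ℕ → List B
  | 0 => []
  | k + 1 => s :: altWord t s k

/-- The glued product `x * y` of two words: the concatenation of `x` and `y` with one of the
two adjacent occurrences of the common letter deleted (intended for use when the last letter
of `x` equals the first letter of `y`). -/
def glueWord {B : Type*} (x y : List B) : List B := x ++ y.tail

/-- Iterated glued product `g₁ * g₂ * ⋯ * gₘ`. -/
def glueFold {B : Type*} : List (List B) → List B
  | [] => []
  | g :: rest => rest.foldl glueWord g

/-- `segs` is the list of dihedral segments of the word `x`: the maximal contiguous subwords of
`x` involving (at most) two distinct letters.  Each segment alternates in two distinct letters,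
consecutive segments overlap in one letter (so that the glued product of the segments is `x`),
and maximality is expressed by requiring that consecutive segments have different letter sets. -/
def IsDihedralDecomp {B : Type*} (x : List B) (segs : List (List B)) : Prop :=
  segs ≠ [] ∧
  (∀ seg ∈ segs, ∃ s t : B, s ≠ t ∧ seg ≠ [] ∧ seg = altWord s t seg.length) ∧
  (2 ≤ segs.length → ∀ seg ∈ segs, 2 ≤ seg.length) ∧
  segs.Chain' (fun u v => u.getLast? = v.head? ∧ ({a | a ∈ u} : Set B) ≠ {a | a ∈ v}) ∧
  x = glueFold segs

variable {B : Type*} {W : Type*} [Group W]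

/-- `ω` is the unique reduced word of `w`. -/
def IsUniqueReducedWord {M : CoxeterMatrix B} (cs : CoxeterSystem M W)
    (w : W) (ω : List B) : Prop :=
  cs.wordProd ω = w ∧ cs.IsReduced ω ∧
    ∀ ω' : List B, cs.wordProd ω' = w → cs.IsReduced ω' → ω' = ω

/-- The subregular set `C`: the non-identity elements of `W` admitting exactly one
reduced word. -/
def subregularSet {M : CoxeterMatrix B} (cs : CoxeterSystem M W) : Set W :=
  {w | w ≠ 1 ∧ ∃ ω : List B, IsUniqueReducedWord cs w ω}

/-- `Γ_s ∩ Γ_s⁻¹`: the elements of the subregular set whose unique reduced word both starts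
and ends with `s`. -/
def gammaSet {M : CoxeterMatrix B} (cs : CoxeterSystem M W) (s : B) : Set W :=
  {w | w ≠ 1 ∧ ∃ ω : List B, IsUniqueReducedWord cs w ω ∧
    ω.head? = some s ∧ ω.getLast? = some s}

section DihedralReflections

variable {V : Type*} [AddCommGroup V] [Module ℝ V] {x y : V} {f g : Module.Dual ℝ V}

/-- Powers of a product of two reflections whose roots meet at angle `π - θ`, on the first root. -/
theorem sin_smul_preReflection_mul_pow_left (θ : ℝ) (hf : f x = 2) (hg : g y = 2)
    (hfy : f y = -2 * Real.cos θ) (hgx : g x = -2 * Real.cos θ) (k : ℕ) :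
    Real.sin θ • ((Module.preReflection x f * Module.preReflection y g) ^ k) x =
      Real.sin ((2 * k + 1) * θ) • x + Real.sin (2 * k * θ) • y := by
  induction k with
  | zero => simp
  | succ k ih =>
    rw [pow_succ', Module.End.mul_apply, ← map_smul, ih]
    simp only [Module.End.mul_apply, Module.preReflection_apply, map_add, map_sub, map_smul, hf,
      hg, hfy, hgx]
    have e1 : Real.sin ((2 * (k + 1 : ℕ) + 1) * θ) =
        2 * Real.cos θ * Real.sin (2 * (k + 1) * θ) - Real.sin ((2 * k + 1) * θ) := by
      have h1 : (2 * ((k + 1 : ℕ) : ℝ) + 1) * θ = 2 * (k + 1) * θ + θ := by push_cast; ring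
      have h2 : (2 * (k : ℝ) + 1) * θ = 2 * (k + 1) * θ - θ := by ring
      rw [h1, h2, Real.sin_add, Real.sin_sub]; ring
    have e2 : Real.sin (2 * (k + 1) * θ) =
        2 * Real.cos θ * Real.sin ((2 * k + 1) * θ) - Real.sin (2 * k * θ) := by
      have h1 : 2 * ((k : ℝ) + 1) * θ = (2 * k + 1) * θ + θ := by ring
      have h2 : 2 * (k : ℝ) * θ = (2 * k + 1) * θ - θ := by ring
      rw [h1, h2, Real.sin_add, Real.sin_sub]; ring
    rw [e1]
    push_cast
    rw [e2]
    module

/-- Powers of a product of two reflections whose roots meet at angle `π - θ`, on the second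
root. -/
theorem sin_smul_preReflection_mul_pow_right (θ : ℝ) (hf : f x = 2) (hg : g y = 2)
    (hfy : f y = -2 * Real.cos θ) (hgx : g x = -2 * Real.cos θ) (k : ℕ) :
    Real.sin θ • ((Module.preReflection x f * Module.preReflection y g) ^ k) y =
      -Real.sin (2 * k * θ) • x - Real.sin ((2 * k - 1) * θ) • y := by
  induction k with
  | zero => simp
  | succ k ih =>
    rw [pow_succ', Module.End.mul_apply, ← map_smul, ih]
    simp only [Module.End.mul_apply, Module.preReflection_apply, map_sub, map_smul, hf,
      hg, hfy, hgx]
    have e1 : Real.sin (2 * (k + 1 : ℕ) * θ) =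
        2 * Real.cos θ * Real.sin ((2 * (k + 1) - 1) * θ) - Real.sin (2 * k * θ) := by
      have h1 : 2 * ((k + 1 : ℕ) : ℝ) * θ = (2 * (k + 1) - 1) * θ + θ := by push_cast; ring
      have h2 : 2 * (k : ℝ) * θ = (2 * (k + 1) - 1) * θ - θ := by ring
      rw [h1, h2, Real.sin_add, Real.sin_sub]; ring
    have e2 : Real.sin ((2 * (k + 1) - 1) * θ) =
        2 * Real.cos θ * Real.sin (2 * k * θ) - Real.sin ((2 * k - 1) * θ) := by
      have h1 : (2 * ((k : ℝ) + 1) - 1) * θ = 2 * k * θ + θ := by ring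
      have h2 : (2 * (k : ℝ) - 1) * θ = 2 * k * θ - θ := by ring
      rw [h1, h2, Real.sin_add, Real.sin_sub]; ring
    rw [e1]
    push_cast
    rw [e2]
    module

/-- The parabolic limit of `sin_smul_preReflection_mul_pow_left`. -/
theorem preReflection_mul_pow_left_of_parabolic (hf : f x = 2) (hg : g y = 2)
    (hfy : f y = -2) (hgx : g x = -2) (k : ℕ) :
    ((Module.preReflection x f * Module.preReflection y g) ^ k) x =
      (2 * k + 1 : ℝ) • x + (2 * k : ℝ) • y := by
  induction k with
  | zero => simp
  | succ k ih =>
    rw [pow_succ', Module.End.mul_apply, ih]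
    simp only [Module.End.mul_apply, Module.preReflection_apply, map_add, map_sub, map_smul, hf,
      hg, hfy, hgx]
    push_cast
    module

theorem sin_pi_div_natCast_pos {m : ℕ} (hm : 2 ≤ m) : 0 < Real.sin (Real.pi / m) := by
  have h2 : (2 : ℝ) ≤ m := by exact_mod_cast hm
  refine Real.sin_pos_of_pos_of_lt_pi (by positivity) ?_
  exact div_lt_self Real.pi_pos (by linarith)

theorem preReflection_mul_pow_eq_one {m : ℕ} (hm : 2 ≤ m) (hf : f x = 2) (hg : g y = 2)
    (hfy : f y = -2 * Real.cos (Real.pi / m)) (hgx : g x = -2 * Real.cos (Real.pi / m)) :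
    (Module.preReflection x f * Module.preReflection y g) ^ m = 1 := by
  have hsin := sin_pi_div_natCast_pos hm
  have hx := sin_smul_preReflection_mul_pow_left _ hf hg hfy hgx m
  have hy := sin_smul_preReflection_mul_pow_right _ hf hg hfy hgx m
  set θ := Real.pi / m with hθ
  have hmθ : 2 * m * θ = 2 * Real.pi := by
    have : (m : ℝ) ≠ 0 := by positivity
    rw [hθ]; field_simp
  rw [add_mul, one_mul, hmθ, add_comm (2 * Real.pi), Real.sin_add_two_pi, Real.sin_two_pi, zero_smul,
    add_zero] at hx
  rw [sub_mul, one_mul, hmθ, Real.sin_two_pi, Real.sin_two_pi_sub, neg_zero, zero_smul,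
    zero_sub, neg_smul, neg_neg] at hy
  have hx := smul_right_injective V hsin.ne' hx
  have hy := smul_right_injective V hsin.ne' hy
  ext v
  set a := (f v + Real.cos θ * g v) / (2 * Real.sin θ ^ 2) with ha
  set b := (g v + Real.cos θ * f v) / (2 * Real.sin θ ^ 2) with hb
  have hsc := Real.sin_sq_add_cos_sq θ
  set v' := v - a • x - b • y with hv'
  have hfv : f v' = 0 := by
    simp only [hv', map_sub, map_smul, hf, hfy, smul_eq_mul, ha, hb]
    field_simp
    linear_combination f v * hsc
  have hgv : g v' = 0 := by
    simp only [hv', map_sub, map_smul, hg, hgx, smul_eq_mul, ha, hb]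
    field_simp
    linear_combination g v * hsc
  have hfix : (Module.preReflection x f * Module.preReflection y g) v' = v' := by
    simp [Module.preReflection_apply, hfv, hgv]
  have hfix' : ((Module.preReflection x f * Module.preReflection y g) ^ m) v' = v' := by
    rw [Module.End.pow_apply]
    exact Function.iterate_fixed hfix m
  have hv : v = v' + a • x + b • y := by rw [hv']; abel
  rw [hv, map_add, map_add, map_smul, map_smul, hfix', hx, hy, Module.End.one_apply]

end DihedralReflections

namespace CoxeterSystem
variable {M : CoxeterMatrix B} (cs : CoxeterSystem M W)

/-- The simple coroots of the geometric representation on `B →₀ ℝ`. -/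
noncomputable def geometricCoroot (M : CoxeterMatrix B) (i : B) : Module.Dual ℝ (B →₀ ℝ) :=
  Finsupp.linearCombination ℝ fun j => -2 * Real.cos (Real.pi / M i j)

theorem geometricCoroot_single (i j : B) :
    geometricCoroot M i (Finsupp.single j 1) = -2 * Real.cos (Real.pi / M i j) := by
  simp [geometricCoroot]

theorem geometricCoroot_self (i : B) : geometricCoroot M i (Finsupp.single i 1) = 2 := by
  simp [geometricCoroot_single]

theorem geometricCoroot_comm (i j : B) :
    geometricCoroot M j (Finsupp.single i 1) = -2 * Real.cos (Real.pi / M i j) := by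
  rw [geometricCoroot_single, M.symmetric]

theorem two_le_of_ne {i j : B} (hij : i ≠ j) (h0 : M i j ≠ 0) : 2 ≤ M i j := by
  have := M.off_diagonal i j hij
  omega

theorem isLiftable_geometric :
    M.IsLiftable fun i => Module.preReflection (Finsupp.single i (1 : ℝ)) (geometricCoroot M i) := by
  intro i j
  by_cases hij : i = j
  · subst hij
    rw [M.diagonal, pow_one]
    refine LinearMap.ext fun v => ?_
    rw [Module.End.mul_apply, Module.End.one_apply]
    exact Module.involutive_preReflection (geometricCoroot_self i) v
  by_cases h0 : M i j = 0
  · rw [h0, pow_zero]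
  exact preReflection_mul_pow_eq_one (two_le_of_ne hij h0) (geometricCoroot_self i)
    (geometricCoroot_self j) (geometricCoroot_single i j) (geometricCoroot_comm i j)

/-- The product of two distinct simple reflections has order exactly `M i j`. -/
theorem dvd_of_simple_mul_simple_pow_eq_one {i j : B} (hij : i ≠ j) {k : ℕ}
    (hk : (cs.simple i * cs.simple j) ^ k = 1) : M i j ∣ k := by
  have h1 := congrArg (cs.lift ⟨_, isLiftable_geometric⟩) hk
  rw [map_pow, map_mul, map_one, cs.lift_apply_simple, cs.lift_apply_simple] at h1
  have h2 := congrArg (fun T : Module.End ℝ (B →₀ ℝ) => T (Finsupp.single i 1)) h1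
  simp only [Module.End.one_apply] at h2
  have hi := geometricCoroot_self (M := M) i
  have hj := geometricCoroot_self (M := M) j
  have hs := geometricCoroot_single (M := M) i j
  have hc := geometricCoroot_comm (M := M) i j
  by_cases h0 : M i j = 0
  · rw [h0, Nat.cast_zero, div_zero, Real.cos_zero, mul_one] at hs hc
    rw [preReflection_mul_pow_left_of_parabolic hi hj hs hc] at h2
    have h3 := DFunLike.congr_fun h2 j
    simp [hij] at h3
    simp [h3]
  · have hm := two_le_of_ne hij h0
    have hsin := sin_pi_div_natCast_pos hm
    have h3 := sin_smul_preReflection_mul_pow_left _ hi hj hs hc k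
    rw [h2] at h3
    set θ := Real.pi / M i j with hθ
    have h4 := DFunLike.congr_fun h3 j
    have h5 := DFunLike.congr_fun h3 i
    simp [hij] at h4
    simp [hij] at h5
    rw [add_mul, one_mul, Real.sin_add, ← h4, zero_mul, zero_add] at h5
    have h6 : Real.cos (2 * k * θ) = 1 := by
      have := mul_right_cancel₀ hsin.ne' ((one_mul _).trans h5)
      exact this.symm
    obtain ⟨n, hn⟩ := (Real.cos_eq_one_iff _).1 h6
    have hM : (M i j : ℝ) ≠ 0 := by exact_mod_cast h0
    have h7 : (n * M i j : ℝ) = k := by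
      have := Real.pi_pos.ne'
      rw [hθ] at hn
      field_simp at hn
      linarith
    have h8 : (n * M i j : ℤ) = k := by exact_mod_cast h7
    exact Int.natCast_dvd_natCast.1 ⟨n, by rw [← h8]; ring⟩

section Exchange

open scoped Classical in
/-- The action of a simple reflection on pairs of a group element and a sign, which records
whether the element is an inversion. -/
noncomputable def signedConj (i : B) : Function.End (W × ZMod 2) := fun p =>
  (cs.simple i * p.1 * cs.simple i, p.2 + if p.1 = cs.simple i then 1 else 0)

open scoped Classical in
theorem signedConj_mul_pow_apply (i j : B) (k : ℕ) (p : W × ZMod 2) :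
    ((cs.signedConj i * cs.signedConj j) ^ k) p =
      ((cs.simple i * cs.simple j) ^ k * p.1 * ((cs.simple i * cs.simple j) ^ k)⁻¹,
        p.2 + ∑ n ∈ Finset.range (2 * k),
          if p.1 = cs.simple j * (cs.simple i * cs.simple j) ^ n then 1 else 0) := by
  induction k with
  | zero => simp [Function.End.one_def]
  | succ k ih =>
    rw [pow_succ']
    rw [show ((cs.signedConj i * cs.signedConj j) * (cs.signedConj i * cs.signedConj j) ^ k) p = cs.signedConj i (cs.signedConj j (((cs.signedConj i * cs.signedConj j) ^ k) p)) from rfl, ih]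
    set d := cs.simple i * cs.simple j with hd
    have hjd (n : ℕ) : cs.simple j * d ^ n = (d ^ n)⁻¹ * cs.simple j := by
      have hinv : cs.simple j * d * (cs.simple j)⁻¹ = d⁻¹ := by
        rw [hd, ← mul_assoc, mul_inv_rev, inv_simple, inv_simple, mul_assoc,
          mul_assoc, simple_mul_simple_self, mul_one]
      have h := conj_pow (i := n) (a := cs.simple j) (b := d)
      rw [hinv, inv_pow] at h
      rw [h]; group
    have h1 : (d ^ k * p.1 * (d ^ k)⁻¹ = cs.simple j) ↔ p.1 = cs.simple j * d ^ (2 * k) := by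
      rw [two_mul, pow_add, ← mul_assoc, hjd, mul_inv_eq_iff_eq_mul, mul_assoc,
        eq_inv_mul_iff_mul_eq]
    have h2 : (cs.simple j * (d ^ k * p.1 * (d ^ k)⁻¹) * cs.simple j = cs.simple i) ↔
        p.1 = cs.simple j * d ^ (2 * k + 1) := by
      have h3 : cs.simple j * d ^ (2 * k + 1) = (d ^ k)⁻¹ * (cs.simple j * d) * d ^ k := by
        rw [← mul_assoc, ← hjd, mul_assoc, mul_assoc, ← pow_succ', ← pow_add]
        congr 2; ring
      have h4 (X : W) : cs.simple j * X * cs.simple j = cs.simple i ↔ X = cs.simple j * d := by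
        rw [← eq_mul_inv_iff_mul_eq, ← eq_inv_mul_iff_mul_eq, inv_simple, hd]
      rw [h3, h4, mul_inv_eq_iff_eq_mul, mul_assoc (d ^ k)⁻¹, eq_inv_mul_iff_mul_eq]
    simp only [signedConj, h1, h2]
    rw [mul_add, mul_one, Finset.sum_range_succ, Finset.sum_range_succ]
    refine Prod.ext ?_ ?_
    · simp [pow_succ', hd, mul_assoc]
    · simp only [add_assoc]

theorem isLiftable_signedConj : M.IsLiftable cs.signedConj := by
  classical
  intro i j
  funext p
  rw [signedConj_mul_pow_apply, cs.simple_mul_simple_pow, two_mul, Finset.sum_range_add]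
  simp only [pow_add, cs.simple_mul_simple_pow, one_mul]
  rw [CharTwo.add_self_eq_zero]
  simp [Function.End.one_def]

open scoped Classical in
theorem lift_signedConj_wordProd (ω : List B) (p : W × ZMod 2) :
    cs.lift ⟨_, cs.isLiftable_signedConj⟩ (cs.wordProd ω) p =
      (cs.wordProd ω * p.1 * (cs.wordProd ω)⁻¹, p.2 + (cs.rightInvSeq ω).count p.1) := by
  induction ω with
  | nil => simp [Function.End.one_def]
  | cons i ω ih =>
    rw [wordProd_cons, map_mul]
    change cs.lift ⟨_, cs.isLiftable_signedConj⟩ (cs.simple i)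
      (cs.lift ⟨_, cs.isLiftable_signedConj⟩ (cs.wordProd ω) p) = _
    rw [ih, cs.lift_apply_simple, signedConj]
    refine Prod.ext ?_ ?_
    · simp [mul_assoc]
    · have h : (cs.wordProd ω * p.1 * (cs.wordProd ω)⁻¹ = cs.simple i) ↔
          (cs.wordProd ω)⁻¹ * cs.simple i * cs.wordProd ω = p.1 := by
        rw [mul_inv_eq_iff_eq_mul, mul_assoc, inv_mul_eq_iff_eq_mul, eq_comm]
      simp only [h, rightInvSeq, List.count_cons, beq_iff_eq]
      push_cast
      ring

theorem simple_mem_rightInvSeq_of_isRightDescent {ω : List B} {i : B}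
    (hi : cs.IsRightDescent (cs.wordProd ω) i) : cs.simple i ∈ cs.rightInvSeq ω := by
  classical
  obtain ⟨ρ, hρ, hρω⟩ := cs.exists_isReduced (cs.wordProd ω * cs.simple i)
  have hprod : cs.wordProd (ρ.concat i) = cs.wordProd ω := by
    rw [wordProd_concat, ← hρω, simple_mul_simple_cancel_right]
  have hred : cs.IsReduced (ρ.concat i) := by
    rw [IsReduced, hprod, List.length_concat, ← hρ.eq, ← hρω]
    exact (cs.isRightDescent_iff.1 hi).symm
  have hmem : cs.simple i ∈ cs.rightInvSeq (ρ.concat i) := by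
    rw [rightInvSeq_concat]; simp
  have hcount := List.count_eq_one_of_mem hred.nodup_rightInvSeq hmem
  have h1 := cs.lift_signedConj_wordProd (ρ.concat i) (cs.simple i, 0)
  rw [hprod, lift_signedConj_wordProd, hcount] at h1
  have h2 := congrArg Prod.snd h1
  by_contra hnot
  simp [List.count_eq_zero_of_not_mem hnot] at h2

theorem simple_mem_leftInvSeq_of_isLeftDescent {ω : List B} {i : B}
    (hi : cs.IsLeftDescent (cs.wordProd ω) i) : cs.simple i ∈ cs.leftInvSeq ω := by
  have h := cs.simple_mem_rightInvSeq_of_isRightDescent (ω := ω.reverse) (i := i)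
    (by rwa [wordProd_reverse, isRightDescent_inv_iff])
  simpa [rightInvSeq_reverse] using h

theorem leftInvSeq_append (ω ω' : List B) :
    cs.leftInvSeq (ω ++ ω') =
      cs.leftInvSeq ω ++ (cs.leftInvSeq ω').map (MulAut.conj (cs.wordProd ω)) := by
  induction ω with
  | nil => simp
  | cons i ω ih =>
    simp [leftInvSeq, ih, wordProd_cons, Function.comp_def, mul_assoc]

theorem exists_eraseIdx_of_mem_leftInvSeq {ω : List B} {r : W} (hr : r ∈ cs.leftInvSeq ω) :
    ∃ ω', ω'.length + 1 = ω.length ∧ r * cs.wordProd ω = cs.wordProd ω' := by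
  obtain ⟨n, hn, rfl⟩ := List.mem_iff_getElem.1 hr
  refine ⟨ω.eraseIdx n, ?_, ?_⟩
  · rw [length_leftInvSeq] at hn
    rw [List.length_eraseIdx_of_lt hn]
    omega
  · rw [← getD_leftInvSeq_mul_wordProd, List.getD_eq_getElem _ _ hn]

end Exchange

theorem wordProd_altWord_two_mul (s t : B) (k : ℕ) :
    cs.wordProd (altWord s t (2 * k)) = (cs.simple s * cs.simple t) ^ k := by
  induction k with
  | zero => simp [altWord]
  | succ k ih =>
    rw [mul_add, mul_one, altWord, altWord, wordProd_cons, wordProd_cons, ih, pow_succ', mul_assoc]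

theorem length_altWord (s t : B) (k : ℕ) : (altWord s t k).length = k := by
  induction k generalizing s t with
  | zero => rfl
  | succ k ih => simp [altWord, ih]

theorem reverse_altWord (s t : B) (k : ℕ) : (altWord s t k).reverse = alternatingWord t s k := by
  induction k generalizing s t with
  | zero => rfl
  | succ k ih => simp [altWord, alternatingWord_succ, ih]

theorem wordProd_altWord_comm (s t : B) :
    cs.wordProd (altWord s t (M s t)) = cs.wordProd (altWord t s (M s t)) := by
  have h := cs.wordProd_braidWord_eq t s
  rw [braidWord, braidWord, M.symmetric t s, ← reverse_altWord, ← reverse_altWord,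
    wordProd_reverse, wordProd_reverse, inv_inj] at h
  exact h

theorem exists_pow_of_mem_leftInvSeq_altWord {s t : B} {k : ℕ} {r : W}
    (hr : r ∈ cs.leftInvSeq (altWord s t k)) :
    ∃ n < k, r = (cs.simple s * cs.simple t) ^ n * cs.simple s := by
  induction k generalizing s t r with
  | zero => simp [altWord] at hr
  | succ k ih =>
    simp only [altWord, leftInvSeq, List.mem_cons, List.mem_map] at hr
    obtain rfl | ⟨r', hr', rfl⟩ := hr
    · exact ⟨0, by omega, by simp⟩
    · obtain ⟨n, hn, rfl⟩ := ih hr'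
      refine ⟨n + 1, by omega, ?_⟩
      rw [MulAut.conj_apply, inv_simple, mul_pow_mul, ← mul_assoc, ← pow_succ']

end CoxeterSystem

namespace CoxeterSystem

variable {M : CoxeterMatrix B} (cs : CoxeterSystem M W)

/-- An element with two distinct left descents `s` and `t` has a reduced word starting with any
alternating word in `s` and `t` of length at most `M s t`. -/
theorem exists_reduced_altWord_append {v : W} (k : ℕ) {s t : B} (hst : s ≠ t)
    (hs : cs.IsLeftDescent v s) (ht : cs.IsLeftDescent v t) (hk : M s t = 0 ∨ k ≤ M s t) :
    ∃ u, cs.wordProd (altWord s t k ++ u) = v ∧ cs.IsReduced (altWord s t k ++ u) := by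
  induction k generalizing s t with
  | zero =>
    obtain ⟨u, hu, rfl⟩ := cs.exists_isReduced v
    exact ⟨u, rfl, hu⟩
  | succ k ih =>
    obtain ⟨u, hu, hred⟩ := ih hst.symm ht hs (by rw [M.symmetric t s]; omega)
    have hmem := cs.simple_mem_leftInvSeq_of_isLeftDescent (ω := altWord t s k ++ u) (i := s)
      (by rwa [hu])
    rw [leftInvSeq_append, List.mem_append, List.mem_map] at hmem
    obtain hmem | ⟨r, hr, hrs⟩ := hmem
    · obtain ⟨n, hn, h⟩ := cs.exists_pow_of_mem_leftInvSeq_altWord hmem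
      have hpow : (cs.simple t * cs.simple s) ^ (n + 1) = 1 := by
        rw [pow_succ, ← mul_assoc, ← h, simple_mul_simple_self]
      have hdvd := cs.dvd_of_simple_mul_simple_pow_eq_one hst.symm hpow
      rw [M.symmetric t s] at hdvd
      obtain h0 | hle := hk
      · rw [h0] at hdvd
        exact absurd (Nat.eq_zero_of_zero_dvd hdvd) (by omega)
      · have := Nat.le_of_dvd (by omega) hdvd
        omega
    · obtain ⟨u', hlen, hu'⟩ := cs.exists_eraseIdx_of_mem_leftInvSeq hr
      have hprod : cs.wordProd (altWord s t (k + 1) ++ u') = v := by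
        rw [altWord, List.cons_append, wordProd_cons, wordProd_append, ← hu', ← hrs, ← hu,
          wordProd_append, MulAut.conj_apply]
        simp only [mul_assoc, inv_mul_cancel_left]
        rw [← mul_assoc r r, (cs.isReflection_of_mem_leftInvSeq u hr).mul_self, one_mul]
      refine ⟨u', hprod, ?_⟩
      rw [IsReduced, hprod, ← hu, hred.eq]
      simp only [List.length_append, length_altWord]
      omega

/-- A word with neither adjacent repetitions nor braid factors is the unique reduced word of its
product. -/
theorem isUniqueReducedWord_of_no_braid {x : List B} (hchain : x.IsChain (· ≠ ·))
    (hbraid : ∀ s t : B, s ≠ t → M s t ≠ 0 → ¬ altWord s t (M s t) <:+: x) :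
    IsUniqueReducedWord cs (cs.wordProd x) x := by
  induction x with
  | nil =>
    refine ⟨rfl, by simp [IsReduced], fun ω hω hred => ?_⟩
    rw [IsReduced, hω] at hred
    simpa using hred.symm
  | cons s y ih =>
    obtain ⟨-, hyred, hyuniq⟩ := ih hchain.tail fun a b hab h0 h =>
      hbraid a b hab h0 (h.trans (List.suffix_cons s y).isInfix)
    have hdesc : ¬ cs.IsLeftDescent (cs.wordProd y) s := by
      intro hd
      obtain ⟨ρ, hρ, hρy⟩ := cs.exists_isReduced (cs.simple s * cs.wordProd y)
      have hprod : cs.wordProd (s :: ρ) = cs.wordProd y := by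
        rw [wordProd_cons, ← hρy, simple_mul_simple_cancel_left]
      have hy := hyuniq (s :: ρ) hprod (by
        rw [IsReduced, hprod, List.length_cons, ← hρ.eq, ← hρy]
        exact (cs.isLeftDescent_iff.1 hd).symm)
      rw [← hy, List.isChain_cons_cons] at hchain
      exact hchain.1 rfl
    have hlen : cs.length (cs.wordProd (s :: y)) = y.length + 1 := by
      rw [wordProd_cons, cs.not_isLeftDescent_iff.1 hdesc, hyred.eq]
    have htail {z : List B} (hz : cs.wordProd (s :: z) = cs.wordProd (s :: y))
        (hzred : cs.IsReduced (s :: z)) : z = y := by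
      rw [wordProd_cons, wordProd_cons] at hz
      exact hyuniq z (mul_left_cancel hz) (hzred.drop 1)
    refine ⟨rfl, hlen, fun ω hω hred => ?_⟩
    cases ω with
    | nil =>
      rw [IsReduced, hω, hlen] at hred
      simp at hred
    | cons t z =>
      by_cases hst : s = t
      · subst hst
        rw [htail hω hred]
      exfalso
      have hs : cs.IsLeftDescent (cs.wordProd (s :: y)) s := by
        rw [IsLeftDescent, hlen, wordProd_cons, simple_mul_simple_cancel_left, hyred.eq]
        omega
      have ht : cs.IsLeftDescent (cs.wordProd (s :: y)) t := by
        rw [← hω, IsLeftDescent, hred.eq, wordProd_cons, simple_mul_simple_cancel_left]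
        exact Nat.lt_succ_of_le (cs.length_wordProd_le z)
      by_cases h0 : M s t = 0
      · obtain ⟨u, hu, hured⟩ :=
          cs.exists_reduced_altWord_append (y.length + 2) hst hs ht (Or.inl h0)
        rw [IsReduced, hu, hlen, List.length_append, length_altWord] at hured
        omega
      · obtain ⟨u, hu, hured⟩ :=
          cs.exists_reduced_altWord_append (M s t) hst hs ht (Or.inr le_rfl)
        refine hbraid s t hst h0 ?_
        obtain ⟨m, hm⟩ := Nat.exists_eq_succ_of_ne_zero h0
        rw [hm, Nat.succ_eq_add_one, altWord, List.cons_append] at hu hured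
        rw [hm, Nat.succ_eq_add_one, altWord, ← htail hu hured]
        exact (List.prefix_append (s :: altWord t s m) u).isInfix

end CoxeterSystem

section DihedralSegments

theorem glueFold_cons (g : List B) (rest : List (List B)) :
    glueFold (g :: rest) = g ++ (rest.map List.tail).flatten := by
  rw [glueFold]
  induction rest generalizing g with
  | nil => simp
  | cons h rest ih => simp [ih, glueWord]

theorem isInfix_glueFold {segs : List (List B)} (hne : ∀ g ∈ segs, g ≠ [])
    (hchain : segs.IsChain fun u v => u.getLast? = v.head?) {g : List B} (hg : g ∈ segs) :
    g <:+: glueFold segs := by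
  induction segs with
  | nil => simp at hg
  | cons h rest ih =>
    rw [List.mem_cons] at hg
    obtain rfl | hg := hg
    · rw [glueFold_cons]
      exact (List.prefix_append _ _).isInfix
    refine (ih (fun a ha => hne a (List.mem_cons_of_mem _ ha)) hchain.tail hg).trans ?_
    cases rest with
    | nil => simp at hg
    | cons h' rest =>
      refine List.IsSuffix.isInfix ⟨h.dropLast, ?_⟩
      have hh' := hne h' (by simp)
      have hh := hne h (by simp)
      rw [List.isChain_cons_cons, List.getLast?_eq_getLast_of_ne_nil hh,
        List.head?_eq_some_head hh', Option.some_inj] at hchain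
      rw [glueFold_cons, glueFold_cons, List.map_cons, List.flatten_cons, ← List.append_assoc,
        ← List.append_assoc]
      congr 1
      conv_lhs => rw [← List.cons_head_tail hh', ← hchain.1]
      conv_rhs => rw [← List.dropLast_append_getLast hh]
      simp

theorem altWord_prefix_altWord (s t : B) {k l : ℕ} (h : k ≤ l) :
    altWord s t k <+: altWord s t l := by
  induction k generalizing s t l with
  | zero => exact List.nil_prefix
  | succ k ih =>
    obtain _ | l := l
    · omega
    exact (List.prefix_cons_inj s).2 (ih t s (by omega))

theorem eq_or_eq_of_mem_altWord {s t a : B} {k : ℕ} (h : a ∈ altWord s t k) : a = s ∨ a = t := by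
  induction k generalizing s t with
  | zero => simp [altWord] at h
  | succ k ih =>
    rw [altWord, List.mem_cons] at h
    exact h.elim Or.inl fun h => (ih h).symm

/-- Every word of length at least two without adjacent repetitions splits into dihedral segments
that together contain all its alternating infixes. -/
theorem exists_dihedralDecomp (a b : B) (x : List B) (hchain : (a :: b :: x).IsChain (· ≠ ·)) :
    ∃ g segs, IsDihedralDecomp (a :: b :: x) ((a :: b :: g) :: segs) ∧
      (∀ seg ∈ (a :: b :: g) :: segs, 2 ≤ seg.length) ∧
      (∀ (s t : B) (m : ℕ), altWord s t m <+: a :: b :: x → altWord s t m <+: a :: b :: g) ∧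
      ∀ (s t : B) (m : ℕ), 2 ≤ m → altWord s t m <:+: a :: b :: x →
        ∃ seg ∈ (a :: b :: g) :: segs, altWord s t m <:+: seg := by
  induction x generalizing a b with
  | nil =>
    have hab : a ≠ b := by simpa using hchain
    refine ⟨[], [], ⟨by simp, ?_, by simp, List.isChain_singleton _, rfl⟩, by simp, by simp,
      by simp⟩
    simpa using ⟨a, b, hab, rfl⟩
  | cons c x ih =>
    have hab : a ≠ b := (List.isChain_cons_cons.1 hchain).1
    obtain ⟨g, segs, ⟨-, halt, -, hdist, hglue⟩, hlen, hpre, hinf⟩ := ih b c hchain.tail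
    obtain ⟨s, t, hst, -, hseg⟩ := halt (b :: c :: g) (by simp)
    simp only [List.length_cons, altWord, List.cons.injEq] at hseg
    obtain ⟨rfl, rfl, hg⟩ := hseg
    rw [glueFold_cons] at hglue
    rw [List.forall_mem_cons] at halt hlen
    by_cases hac : a = c
    · subst hac
      have hpre' (s t : B) (m : ℕ) (h : altWord s t m <+: a :: b :: a :: x) :
          altWord s t m <+: a :: b :: a :: g := by
        obtain _ | m := m
        · exact List.nil_prefix
        rw [altWord, List.cons_prefix_cons] at h ⊢
        exact ⟨h.1, hpre t s m h.2⟩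
      have hlen' : ∀ seg ∈ (a :: b :: a :: g) :: segs, 2 ≤ seg.length :=
        List.forall_mem_cons.2 ⟨by simp, hlen.2⟩
      refine ⟨a :: g, segs, ⟨by simp, List.forall_mem_cons.2 ⟨⟨a, b, hab, by simp, ?_⟩, halt.2⟩,
        fun _ => hlen', ?_, ?_⟩, hlen', hpre', fun s t m hm h => ?_⟩
      · simp only [List.length_cons, altWord]
        rw [← hg]
      · have hdist' := List.isChain_cons.1 hdist
        refine List.isChain_cons.2 ⟨fun v hv => ?_, hdist'.2⟩
        have hset : {d | d ∈ a :: b :: a :: g} = {d | d ∈ b :: a :: g} := by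
          ext d
          simp
          tauto
        rw [hset, List.getLast?_cons_cons]
        exact hdist'.1 v hv
      · rw [glueFold_cons, hglue]
        rfl
      · rw [List.infix_cons_iff] at h
        obtain h | h := h
        · exact ⟨_, List.mem_cons_self, (hpre' s t m h).isInfix⟩
        · obtain ⟨seg, hseg, hin⟩ := hinf s t m hm h
          rw [List.mem_cons] at hseg
          obtain rfl | hseg := hseg
          · exact ⟨_, List.mem_cons_self, hin.trans (List.suffix_cons a _).isInfix⟩
          · exact ⟨seg, List.mem_cons_of_mem _ hseg, hin⟩
    · have hpre' (s t : B) (m : ℕ) (h : altWord s t m <+: a :: b :: c :: x) :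
          altWord s t m <+: [a, b] := by
        obtain _ | _ | _ | m := m
        · exact List.nil_prefix
        · simp only [altWord, List.cons_prefix_cons] at h ⊢
          exact ⟨h.1, List.nil_prefix⟩
        · simp only [altWord, List.cons_prefix_cons] at h ⊢
          exact ⟨h.1, h.2.1, List.nil_prefix⟩
        · simp only [altWord, List.cons_prefix_cons] at h
          exact absurd (h.1.symm.trans h.2.2.1) hac
      have hlen' : ∀ seg ∈ [a, b] :: (b :: c :: g) :: segs, 2 ≤ seg.length :=
        List.forall_mem_cons.2 ⟨by simp, List.forall_mem_cons.2 hlen⟩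
      refine ⟨[], (b :: c :: g) :: segs, ⟨by simp,
        List.forall_mem_cons.2 ⟨⟨a, b, hab, by simp, rfl⟩, List.forall_mem_cons.2 halt⟩,
        fun _ => hlen', ?_, ?_⟩, hlen', hpre', fun s t m hm h => ?_⟩
      · refine List.isChain_cons_cons.2 ⟨⟨rfl, fun h => ?_⟩, hdist⟩
        have hmem : a ∈ b :: c :: g := (Set.ext_iff.1 h a).1 (by simp)
        rw [hg] at hmem
        exact (eq_or_eq_of_mem_altWord (s := b) (t := c) (k := g.length + 2) hmem).elim hab hac
      · rw [glueFold_cons, hglue]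
        rfl
      · rw [List.infix_cons_iff] at h
        obtain h | h := h
        · exact ⟨_, List.mem_cons_self, (hpre' s t m h).isInfix⟩
        · obtain ⟨seg, hseg, hin⟩ := hinf s t m hm h
          exact ⟨seg, List.mem_cons_of_mem _ hseg, hin⟩

end DihedralSegments

/-- **Subregular criterion.**  A nonempty word `x` is the unique reduced word of an element of
the subregular set `C` iff no letter appears consecutively in `x` and every dihedral segment of
`x`, written as `(s,t)_l` for distinct `s,t`, satisfies `l < m(s,t)` (where `m(s,t) = 0` encodes
`m(s,t) = ∞`). -/
theorem subregular_criterion {M : CoxeterMatrix B} (cs : CoxeterSystem M W)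
    (x : List B) (hx : x ≠ []) :
    (∃ w : W, w ∈ subregularSet cs ∧ IsUniqueReducedWord cs w x) ↔
      (x.Chain' (· ≠ ·) ∧
        ∀ segs : List (List B), IsDihedralDecomp x segs →
          ∀ seg ∈ segs, ∀ (s t : B) (l : ℕ), s ≠ t → seg = altWord s t l →
            (M s t = 0 ∨ l < M s t)) := by
  constructor
  · rintro ⟨w, ⟨-, -⟩, hw, hred, huniq⟩
    refine ⟨List.isChain_iff_forall_rel_of_append_cons_cons.2 ?_, ?_⟩
    · rintro a b p q rfl rfl
      have hprod : cs.wordProd (p ++ a :: a :: q) = cs.wordProd (p ++ q) := by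
        simp [CoxeterSystem.wordProd_append, CoxeterSystem.wordProd_cons]
      have hle := cs.length_wordProd_le (p ++ q)
      rw [← hprod, hred.eq] at hle
      simp at hle
    · rintro segs ⟨-, halt, -, hdist, rfl⟩ seg hseg s t l hst rfl
      by_contra! hlt
      obtain ⟨h0, hle⟩ := hlt
      obtain ⟨p, q, hpq⟩ := ((altWord_prefix_altWord s t hle).isInfix).trans
        (isInfix_glueFold (fun g hg => by
          obtain ⟨-, -, -, hne, -⟩ := halt g hg
          exact hne) (hdist.imp fun _ _ h => h.1) hseg)
      have hprod : cs.wordProd (p ++ altWord t s (M s t) ++ q) = cs.wordProd (glueFold segs) := by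
        rw [← hpq]
        simp only [CoxeterSystem.wordProd_append]
        rw [cs.wordProd_altWord_comm s t]
      have heq := huniq (p ++ altWord t s (M s t) ++ q) (hprod.trans hw) (by
        rw [CoxeterSystem.IsReduced, hprod, hred.eq, ← hpq]
        simp [CoxeterSystem.length_altWord])
      rw [← hpq, List.append_left_inj, List.append_right_inj] at heq
      obtain ⟨m, hm⟩ := Nat.exists_eq_succ_of_ne_zero h0
      rw [hm, Nat.succ_eq_add_one, altWord, altWord, List.cons.injEq] at heq
      exact hst heq.1.symm
  · rintro ⟨hchain, hsegs⟩
    have hx' : IsUniqueReducedWord cs (cs.wordProd x) x := by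
      refine cs.isUniqueReducedWord_of_no_braid hchain fun s t hst h0 hinf => ?_
      have hm := CoxeterSystem.two_le_of_ne hst h0
      match x, hx with
      | [a], _ =>
        have := hinf.length_le
        rw [CoxeterSystem.length_altWord, List.length_singleton] at this
        omega
      | a :: b :: x, _ =>
        obtain ⟨g, segs, hdec, -, -, hcover⟩ := exists_dihedralDecomp a b x hchain
        obtain ⟨seg, hseg, hin⟩ := hcover s t _ hm hinf
        obtain ⟨a', b', hab, -, halt⟩ := hdec.2.1 seg hseg
        have hle := hin.length_le
        rw [CoxeterSystem.length_altWord] at hle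
        have hmem {c : B} (hc : c ∈ altWord s t (M s t)) : c = a' ∨ c = b' :=
          eq_or_eq_of_mem_altWord (halt ▸ hin.subset hc)
        obtain ⟨m, hm'⟩ := Nat.exists_eq_add_of_le' hm
        have hs : s = a' ∨ s = b' := hmem (by simp [hm', altWord])
        have ht : t = a' ∨ t = b' := hmem (by simp [hm', altWord])
        have hM : M a' b' = M s t := by
          obtain rfl | rfl := hs <;> obtain rfl | rfl := ht
          · exact absurd rfl hst
          · rfl
          · exact M.symmetric _ _
          · exact absurd rfl hst
        have := hsegs _ hdec seg hseg a' b' _ hab halt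
        omega
    refine ⟨cs.wordProd x, ⟨fun h1 => hx ?_, x, hx'⟩, hx'⟩
    have hlen := hx'.2.1.eq
    rw [h1, cs.length_one] at hlen
    exact List.length_eq_zero_iff.1 hlen.symm
end

section
/- Let (W,S) be a simply-laced Coxeter system, i.e., m(s,t) ≤ 3 for all distinct s,t ∈ S, and let G be its Coxeter diagram: the simple graph on vertex set S in which distinct s,t are adjacent if and only if m(s,t) = 3. Then the map sending an element w of the subregular set C with unique reduced word s_1 s_2 ⋯ s_k to the sequence (s_1, s_2, …, s_k) is a bijection from C onto the set of nonempty spur-free walks on G, that is, sequences (s_1,…,s_k) of vertices of G with k ≥ 1 such that s_i and s_{i+1} are adjacent for all 1 ≤ i ≤ k−1 and s_{i+2} ≠ s_i for all 1 ≤ i ≤ k−2. -/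
variable {B : Type*} {W : Type*} [Group W]

/-- A word is a spur-free walk on the graph with edges `M s t = 3` when consecutive letters are
adjacent and it never returns immediately to the letter it came from. -/
def IsSpurFree (M : CoxeterMatrix B) (ω : List B) : Prop :=
  ω.IsChain (fun s t => M s t = 3) ∧ ∀ i : ℕ, i + 2 < ω.length → ω[i]? ≠ ω[i + 2]?

section SpurFree

variable {M : CoxeterMatrix B} {s t : B} {l ω : List B}

theorem isSpurFree_nil : IsSpurFree M [] := by
  simp [IsSpurFree]

theorem isSpurFree_singleton : IsSpurFree M [s] := by
  simp [IsSpurFree]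

theorem isSpurFree_cons_cons :
    IsSpurFree M (s :: t :: l) ↔ M s t = 3 ∧ l.head? ≠ some s ∧ IsSpurFree M (t :: l) := by
  unfold IsSpurFree
  rw [List.isChain_cons_cons]
  constructor
  · rintro ⟨⟨hM, hc⟩, h⟩
    refine ⟨hM, ?_, hc, fun i hi => ?_⟩
    · cases l with
      | nil => simp
      | cons a l => simpa [eq_comm] using h 0 (by simp)
    · simpa using h (i + 1) (by simpa using hi)
  · rintro ⟨hM, hl, hc, h⟩
    refine ⟨⟨hM, hc⟩, fun i hi => ?_⟩
    cases i with
    | zero => cases l with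
      | nil => simp at hi
      | cons a l => simpa [eq_comm] using hl
    | succ i => simpa using h i (by simpa using hi)

theorem IsSpurFree.tail (h : IsSpurFree M (s :: ω)) : IsSpurFree M ω := by
  cases ω with
  | nil => exact isSpurFree_nil
  | cons t l => exact (isSpurFree_cons_cons.1 h).2.2

end SpurFree

section PathRepresentation

open Finsupp

open scoped Classical in
/-- The action of the Temperley–Lieb generator of `s` on a basis vector `ω` of the module spanned
by the spur-free walks. -/
noncomputable def pathStep (M : CoxeterMatrix B) (s : B) (ω : List B) : List B →₀ ℤ :=
  if IsSpurFree M ω then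
    match ω with
    | [] => single [s] 1
    | t :: l =>
      if t = s then single (t :: l) (-2)
      else if M s t = 3 then
        if l.head? = some s then single l 1 else single (s :: t :: l) 1
      else 0
  else 0

/-- The linear extension of `pathStep`. These operators satisfy the Temperley–Lieb relations. -/
noncomputable def pathOp (M : CoxeterMatrix B) (s : B) : Module.End ℤ (List B →₀ ℤ) :=
  linearCombination ℤ (pathStep M s)

variable {M : CoxeterMatrix B} {s t : B} {l ω : List B}

theorem ne_of_coxeterMatrix_ne_one (h : M s t ≠ 1) : s ≠ t := by
  rintro rfl
  exact h (M.diagonal s)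

theorem pathOp_single (a : ℤ) : pathOp M s (single ω a) = a • pathStep M s ω := by
  simp [pathOp]

theorem pathStep_cons_self (h : IsSpurFree M (s :: l)) :
    pathStep M s (s :: l) = (-2 : ℤ) • single (s :: l) 1 := by
  simp [pathStep, h]

theorem pathStep_cons_of_eq_two (hM : M s t = 2) : pathStep M t (s :: l) = 0 := by
  have hne : s ≠ t := ne_of_coxeterMatrix_ne_one (M := M) (by lia)
  have hM' : M t s ≠ 3 := by rw [M.symmetric]; lia
  simp [pathStep, hne, hM']

theorem pathStep_cons_of_eq_three (hM : M s t = 3) (h : IsSpurFree M (s :: l)) :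
    ∃ l', IsSpurFree M (t :: l') ∧ pathStep M t (s :: l) = single (t :: l') 1 ∧
      pathStep M s (t :: l') = single (s :: l) 1 := by
  have hne : s ≠ t := ne_of_coxeterMatrix_ne_one (M := M) (by lia)
  have hM' : M t s = 3 := by rwa [M.symmetric]
  by_cases hl : l.head? = some t
  · obtain ⟨l', rfl⟩ := List.head?_eq_some_iff.1 hl
    obtain ⟨-, hl', h'⟩ := isSpurFree_cons_cons.1 h
    exact ⟨l', h', by simp [pathStep, h, hne, hM'], by simp [pathStep, h', hne.symm, hM, hl']⟩
  · have h' : IsSpurFree M (t :: s :: l) := isSpurFree_cons_cons.2 ⟨hM', hl, h⟩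
    exact ⟨s :: l, h', by simp [pathStep, h, hne, hM', hl], by simp [pathStep, h', hne.symm, hM]⟩

/-- The image of a basis vector is zero or a multiple of a spur-free walk starting at `s`. -/
theorem pathStep_eq_smul (M : CoxeterMatrix B) (s : B) (ω : List B) :
    ∃ (a : ℤ) (l : List B), IsSpurFree M (s :: l) ∧
      pathStep M s ω = a • single (s :: l) 1 := by
  by_cases h : IsSpurFree M ω
  · cases ω with
    | nil => exact ⟨1, [], isSpurFree_singleton, by simp [pathStep, h]⟩
    | cons t l =>
      by_cases hts : t = s
      · subst hts
        exact ⟨-2, l, h, pathStep_cons_self h⟩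
      by_cases hM : M s t = 3
      · obtain ⟨l', h', h1, -⟩ := pathStep_cons_of_eq_three (M.symmetric s t ▸ hM) h
        exact ⟨1, l', h', by simpa using h1⟩
      · exact ⟨0, [], isSpurFree_singleton, by simp [pathStep, hts, hM]⟩
  · exact ⟨0, [], isSpurFree_singleton, by simp [pathStep, h]⟩

theorem pathOp_mul_self (M : CoxeterMatrix B) (s : B) :
    pathOp M s * pathOp M s = (-2 : ℤ) • pathOp M s := by
  refine lhom_ext fun ω b => ?_
  obtain ⟨a, l, h, e⟩ := pathStep_eq_smul M s ω
  simp only [Module.End.mul_apply, LinearMap.smul_apply, pathOp_single, map_smul, e,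
    pathStep_cons_self h, one_smul]
  module

theorem pathOp_mul_of_eq_two (hM : M s t = 2) : pathOp M t * pathOp M s = 0 := by
  refine lhom_ext fun ω b => ?_
  obtain ⟨a, l, h, e⟩ := pathStep_eq_smul M s ω
  simp [pathOp_single, e, pathStep_cons_of_eq_two hM, -smul_single]

theorem pathOp_mul_mul_of_eq_three (hM : M s t = 3) :
    pathOp M s * pathOp M t * pathOp M s = pathOp M s := by
  refine lhom_ext fun ω b => ?_
  obtain ⟨a, l, h, e⟩ := pathStep_eq_smul M s ω
  obtain ⟨l', -, h1, h2⟩ := pathStep_cons_of_eq_three hM h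
  simp only [Module.End.mul_apply, pathOp_single, map_smul, e, h1, h2, one_smul]

theorem isLiftable_one_add_pathOp (hsl : ∀ s t : B, s ≠ t → M s t = 2 ∨ M s t = 3) :
    M.IsLiftable (fun s => 1 + pathOp M s) := by
  have hsq (s : B) : (1 + pathOp M s) * (1 + pathOp M s) = 1 := by
    simp only [mul_add, add_mul, one_mul, mul_one, pathOp_mul_self]
    module
  intro s t
  rcases eq_or_ne s t with rfl | hne
  · simpa using hsq s
  rcases hsl s t hne with hM | hM
  · have hcomm : (1 + pathOp M s) * (1 + pathOp M t) = (1 + pathOp M t) * (1 + pathOp M s) := by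
      have h1 := pathOp_mul_of_eq_two hM
      have h2 := pathOp_mul_of_eq_two (M.symmetric s t ▸ hM)
      simp only [mul_add, add_mul, h1, h2, one_mul, mul_one]
      abel
    rw [hM, pow_two]
    nth_rw 1 [hcomm]
    rw [mul_assoc, ← mul_assoc (1 + pathOp M s), hsq, one_mul, hsq]
  · have hbraid : (1 + pathOp M s) * (1 + pathOp M t) * (1 + pathOp M s) =
        (1 + pathOp M t) * (1 + pathOp M s) * (1 + pathOp M t) := by
      have h1 := pathOp_mul_mul_of_eq_three hM
      have h2 := pathOp_mul_mul_of_eq_three (M.symmetric s t ▸ hM)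
      simp only [mul_add, add_mul, h1, h2, one_mul, mul_one, pathOp_mul_self]
      module
    rw [hM]
    calc ((1 + pathOp M s) * (1 + pathOp M t)) ^ 3
        = (1 + pathOp M s) * (1 + pathOp M t) * (1 + pathOp M s) *
            ((1 + pathOp M t) * (1 + pathOp M s) * (1 + pathOp M t)) := by
          simp only [pow_succ, pow_zero, one_mul, mul_assoc]
      _ = (1 + pathOp M s) * ((1 + pathOp M t) * ((1 + pathOp M s) * (1 + pathOp M s)) *
            (1 + pathOp M t)) * (1 + pathOp M s) := by
          rw [← hbraid]
          simp only [mul_assoc]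
      _ = 1 := by rw [hsq, mul_one, hsq, mul_one, hsq]

/-- `pathStep` raises the length of a word by at most one. -/
theorem pathStep_mem_supported (M : CoxeterMatrix B) (s : B) (ω : List B) :
    pathStep M s ω ∈ supported ℤ ℤ {v : List B | v.length < ω.length + 2} := by
  unfold pathStep
  split_ifs
  · split
    · exact single_mem_supported ℤ _ (by simp)
    · split_ifs
      · exact single_mem_supported ℤ _ (by simp)
      · exact single_mem_supported ℤ _ (by simp; lia)
      · exact single_mem_supported ℤ _ (by simp)
      · exact zero_mem _
  · exact zero_mem _

theorem pathStep_mem_supported_of_not_isSpurFree (h : ¬ IsSpurFree M (s :: ω)) :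
    pathStep M s ω ∈ supported ℤ ℤ {v : List B | v.length < ω.length + 1} := by
  unfold pathStep
  split_ifs with hω
  · split
    · exact absurd isSpurFree_singleton h
    · split_ifs with h1 h2 h3
      · exact single_mem_supported ℤ _ (by simp)
      · exact single_mem_supported ℤ _ (by simp)
      · exact absurd (isSpurFree_cons_cons.2 ⟨h2, h3, hω⟩) h
      · exact zero_mem _
  · exact zero_mem _

theorem pathStep_of_isSpurFree (h : IsSpurFree M (s :: ω)) :
    pathStep M s ω = single (s :: ω) 1 := by
  cases ω with
  | nil => simp [pathStep, isSpurFree_nil]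
  | cons t l =>
    obtain ⟨hM, hl, h'⟩ := isSpurFree_cons_cons.1 h
    have hne : t ≠ s := (ne_of_coxeterMatrix_ne_one (M := M) (by lia)).symm
    simp [pathStep, h', hne, hM, hl]

theorem pathOp_mem_supported (s : B) {k : ℕ} {x : List B →₀ ℤ}
    (hx : x ∈ supported ℤ ℤ {v : List B | v.length < k}) :
    pathOp M s x ∈ supported ℤ ℤ {v : List B | v.length < k + 1} := by
  rw [pathOp, linearCombination_apply]
  refine Submodule.sum_mem _ fun v hv => Submodule.smul_mem _ _ ?_
  have hvk : v.length < k := hx hv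
  refine supported_mono ?_ (pathStep_mem_supported M s v)
  intro u (hu : u.length < v.length + 2)
  show u.length < k + 1
  lia

/-- The action of a simply-laced Coxeter group on the module spanned by the spur-free walks. -/
noncomputable def pathRep (cs : CoxeterSystem M W)
    (hsl : ∀ s t : B, s ≠ t → M s t = 2 ∨ M s t = 3) : W →* Module.End ℤ (List B →₀ ℤ) :=
  cs.lift ⟨_, isLiftable_one_add_pathOp hsl⟩

open scoped Classical in
theorem pathRep_wordProd_sub_mem_supported (cs : CoxeterSystem M W)
    (hsl : ∀ s t : B, s ≠ t → M s t = 2 ∨ M s t = 3) (ω : List B) :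
    pathRep cs hsl (cs.wordProd ω) (single [] 1) - (if IsSpurFree M ω then single ω 1 else 0) ∈
      supported ℤ ℤ {v : List B | v.length < ω.length} := by
  induction ω with
  | nil => simp [isSpurFree_nil]
  | cons s ω ih =>
    set x := pathRep cs hsl (cs.wordProd ω) (single [] 1) with hx
    set e : List B →₀ ℤ := if IsSpurFree M ω then single ω 1 else 0 with he
    have hstep : pathRep cs hsl (cs.wordProd (s :: ω)) (single [] 1) = x + pathOp M s x := by
      rw [cs.wordProd_cons, map_mul, Module.End.mul_apply, ← hx, pathRep, cs.lift_apply_simple]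
      simp
    have hmono : supported ℤ ℤ {v : List B | v.length < ω.length} ≤
        supported ℤ ℤ {v : List B | v.length < (s :: ω).length} :=
      supported_mono fun v (hv : v.length < _) => by simp; lia
    have hemem : e ∈ supported ℤ ℤ {v : List B | v.length < (s :: ω).length} := by
      rw [he]
      split_ifs
      · exact single_mem_supported ℤ _ (by simp)
      · exact zero_mem _
    have hop : pathOp M s e - (if IsSpurFree M (s :: ω) then single (s :: ω) 1 else 0) ∈
        supported ℤ ℤ {v : List B | v.length < (s :: ω).length} := by
      split_ifs with h
      · rw [he, if_pos h.tail, pathOp_single, pathStep_of_isSpurFree h]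
        simp
      · rw [he, sub_zero]
        split_ifs
        · rw [pathOp_single, one_smul]
          exact pathStep_mem_supported_of_not_isSpurFree h
        · simp
    rw [hstep]
    convert add_mem (add_mem (hmono ih) hemem) (add_mem (pathOp_mem_supported (M := M) s ih) hop)
      using 1
    rw [map_sub]
    abel

/-- A word for the same element as a spur-free walk is no shorter, and equal to the walk if it has
the same length. -/
theorem eq_of_wordProd_eq_of_isSpurFree (cs : CoxeterSystem M W)
    (hsl : ∀ s t : B, s ≠ t → M s t = 2 ∨ M s t = 3) {ω' : List B} (h : IsSpurFree M ω)
    (hprod : cs.wordProd ω' = cs.wordProd ω) (hlen : ω'.length ≤ ω.length) : ω' = ω := by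
  classical
  have coeff {k : ℕ} {x : List B →₀ ℤ} (hx : x ∈ supported ℤ ℤ {v : List B | v.length < k})
      (hk : k ≤ ω.length) : x ω = 0 := by
    by_contra hne
    exact absurd (hx (mem_support_iff.2 hne)) (not_lt.2 hk)
  have h1 := coeff (pathRep_wordProd_sub_mem_supported cs hsl ω) le_rfl
  have h2 := coeff (pathRep_wordProd_sub_mem_supported cs hsl ω') hlen
  rw [hprod] at h2
  by_contra hne
  rw [if_pos h, Finsupp.sub_apply, single_eq_same, sub_eq_zero] at h1
  rw [Finsupp.sub_apply, h1] at h2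
  split_ifs at h2 <;> simp [hne] at h2

theorem isUniqueReducedWord_of_isSpurFree (cs : CoxeterSystem M W)
    (hsl : ∀ s t : B, s ≠ t → M s t = 2 ∨ M s t = 3) (h : IsSpurFree M ω) :
    IsUniqueReducedWord cs (cs.wordProd ω) ω := by
  have hlen := cs.length_wordProd_le ω
  refine ⟨rfl, ?_, fun ω' hω' hr => ?_⟩
  · obtain ⟨ω', hr, hω'⟩ := cs.exists_isReduced (cs.wordProd ω)
    have := eq_of_wordProd_eq_of_isSpurFree cs hsl h hω'.symm
      (by rw [← hr.eq, ← hω']; exact hlen)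
    rwa [← this]
  · exact eq_of_wordProd_eq_of_isSpurFree cs hsl h hω' (by rw [← hr.eq, hω']; exact hlen)

end PathRepresentation

section UniqueReducedWord

variable {M : CoxeterMatrix B} {cs : CoxeterSystem M W} {w : W} {s t : B}

/-- Replacing a factor of a unique reduced word by another word for the same element, of no greater
length, does not change it. -/
theorem IsUniqueReducedWord.factor_eq {u x y v : List B}
    (h : IsUniqueReducedWord cs w (u ++ x ++ v)) (hxy : cs.wordProd y = cs.wordProd x)
    (hlen : y.length ≤ x.length) : y = x := by
  obtain ⟨hw, hr, huniq⟩ := h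
  have hprod : cs.wordProd (u ++ y ++ v) = cs.wordProd (u ++ x ++ v) := by
    simp only [cs.wordProd_append, hxy]
  have hle := cs.length_wordProd_le (u ++ y ++ v)
  have heq := hr.eq
  rw [hprod] at hle
  have hred : cs.IsReduced (u ++ y ++ v) := by
    unfold CoxeterSystem.IsReduced
    rw [hprod]
    simp only [List.length_append] at hle heq ⊢
    lia
  simpa using huniq _ (hprod.trans hw) hred

theorem IsUniqueReducedWord.eq_three {u v : List B}
    (hsl : ∀ s t : B, s ≠ t → M s t = 2 ∨ M s t = 3)
    (h : IsUniqueReducedWord cs w (u ++ [s, t] ++ v)) : M s t = 3 := by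
  have hne : s ≠ t := by
    rintro rfl
    simpa using h.factor_eq (y := []) (by simp [cs.wordProd_cons]) (by simp)
  refine (hsl s t hne).resolve_left fun hM => hne ?_
  have hpow := cs.simple_mul_simple_pow s t
  have hts : cs.wordProd [t, s] = cs.wordProd [s, t] := by
    rw [hM, pow_two, mul_eq_one_iff_eq_inv] at hpow
    simpa [cs.wordProd_cons] using hpow.symm
  have := h.factor_eq hts (by simp)
  simp only [List.cons.injEq] at this
  exact this.2.1

theorem IsUniqueReducedWord.not_spur {u v : List B}
    (hsl : ∀ s t : B, s ≠ t → M s t = 2 ∨ M s t = 3)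
    (h : IsUniqueReducedWord cs w (u ++ [s, t, s] ++ v)) : False := by
  have hM : M s t = 3 := IsUniqueReducedWord.eq_three (u := u) (v := s :: v) hsl (by simpa using h)
  have hpow := cs.simple_mul_simple_pow s t
  have hts : cs.wordProd [t, s, t] = cs.wordProd [s, t, s] := by
    rw [hM, pow_succ, pow_two] at hpow
    have : cs.simple s * cs.simple t * cs.simple s *
        (cs.simple t * cs.simple s * cs.simple t) = 1 := by
      simpa only [mul_assoc] using hpow
    rw [mul_eq_one_iff_eq_inv] at this
    simpa [cs.wordProd_cons, mul_assoc] using this.symm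
  have := h.factor_eq hts (by simp)
  simp only [List.cons.injEq] at this
  rw [this.1, M.diagonal] at hM
  lia

theorem IsUniqueReducedWord.isSpurFree {ω : List B}
    (hsl : ∀ s t : B, s ≠ t → M s t = 2 ∨ M s t = 3)
    (h : IsUniqueReducedWord cs w ω) : IsSpurFree M ω := by
  refine ⟨List.isChain_iff_getElem.2 fun i hi => ?_, fun i hi hspur => ?_⟩
  · refine IsUniqueReducedWord.eq_three (cs := cs) (w := w) (u := ω.take i) (v := ω.drop (i + 2))
      hsl ?_
    simpa using h
  · refine IsUniqueReducedWord.not_spur (cs := cs) (w := w) (s := ω[i]) (t := ω[i + 1])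
      (u := ω.take i) (v := ω.drop (i + 3)) hsl ?_
    have hlast : ω[i] = ω[i + 2] := by grind
    have hword : ω.take i ++ [ω[i], ω[i + 1], ω[i]] ++ ω.drop (i + 3) = ω := by
      conv_lhs => enter [1, 2, 2, 2, 1]; rw [hlast]
      simp
    rwa [hword]

end UniqueReducedWord

/-- **Theorem A (combinatorial part).** For a simply-laced Coxeter system, the map sending an
element of the subregular set `C` to its unique reduced word is a bijection from `C` onto the
set of nonempty spur-free walks on the Coxeter diagram (whose adjacency is `m(s,t) = 3`). -/
theorem subregular_bijection_spur_free_walks {M : CoxeterMatrix B} (cs : CoxeterSystem M W)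
    (hsl : ∀ s t : B, s ≠ t → M s t = 2 ∨ M s t = 3)
    (f : W → List B)
    (hf : ∀ w ∈ subregularSet cs, IsUniqueReducedWord cs w (f w)) :
    Set.BijOn f (subregularSet cs)
      {ω : List B | ω ≠ [] ∧ ω.Chain' (fun s t => M s t = 3) ∧
        ∀ i : ℕ, i + 2 < ω.length → ω[i]? ≠ ω[i + 2]?} := by
  refine ⟨fun w hw => ?_, fun w hw w' hw' h => ?_, fun ω hω => ?_⟩
  · refine ⟨fun hnil => hw.1 ?_, (hf w hw).isSpurFree hsl⟩
    rw [← (hf w hw).1, hnil, cs.wordProd_nil]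
  · rw [← (hf w hw).1, h, (hf w' hw').1]
  · obtain ⟨hne, hsf⟩ := hω
    have hu := isUniqueReducedWord_of_isSpurFree cs hsl hsf
    have hmem : cs.wordProd ω ∈ subregularSet cs := by
      refine ⟨fun h1 => hne ?_, ω, hu⟩
      rw [← List.length_eq_zero_iff, ← hu.2.1.eq, h1, cs.length_one]
    have hfu := hf _ hmem
    exact ⟨_, hmem, hu.2.2 _ hfu.1 hfu.2.1⟩
end

section
/- Let (W,S) be a simply-laced Coxeter system (m(s,t) ≤ 3 for all distinct s,t ∈ S) whose Coxeter diagram G (the simple graph on S with s,t adjacent iff m(s,t) = 3) is a forest, i.e., contains no cycles. Then for every s ∈ S, the only element of the subregular set C whose unique reduced word both starts and ends with s is the generator s itself; that is, Γ_s ∩ Γ_s^{-1} = {s}. -/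
variable {B : Type*} {W : Type*} [Group W]

/-- The simple reflection attached to `a` in the contragredient of the geometric representation of
a simply-laced Coxeter system: it sends `f` to `b ↦ f b - A a b * f a`, where `A` is the Cartan
matrix with entries `2`, `-1` (if `M a b = 3`) and `0`. -/
noncomputable def simplyLacedReflection {B : Type*} (M : CoxeterMatrix B) (a : B) :
    Function.End (B → ℤ) :=
  open scoped Classical in
  fun f b => f b - (if a = b then 2 else if M a b = 3 then -1 else 0) * f a

theorem isLiftable_simplyLacedReflection {B : Type*} {M : CoxeterMatrix B}
    (hsl : ∀ s t : B, s ≠ t → M s t = 2 ∨ M s t = 3) :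
    M.IsLiftable (simplyLacedReflection M) := by
  classical
  intro a b
  rcases eq_or_ne a b with rfl | hab
  · rw [M.diagonal, pow_one]
    funext f c
    change simplyLacedReflection M a (simplyLacedReflection M a f) c = f c
    simp only [simplyLacedReflection, if_true]
    ring
  · have hba := hab.symm
    rcases hsl a b hab with h | h
    · have h' : M b a = 2 := M.symmetric b a ▸ h
      rw [h, pow_two]
      funext f c
      change simplyLacedReflection M a (simplyLacedReflection M b (simplyLacedReflection M a
        (simplyLacedReflection M b f))) c = f c
      simp only [simplyLacedReflection, if_true, hab, hba, if_false, h, h']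
      norm_num
      split_ifs <;> ring
    · have h' : M b a = 3 := M.symmetric b a ▸ h
      rw [h, pow_succ, pow_two]
      funext f c
      change simplyLacedReflection M a (simplyLacedReflection M b (simplyLacedReflection M a
        (simplyLacedReflection M b (simplyLacedReflection M a
          (simplyLacedReflection M b f))))) c = f c
      simp only [simplyLacedReflection, if_true, hab, hba, if_false, h, h']
      ring

theorem simple_injective_of_simplyLaced {B W : Type*} [Group W] {M : CoxeterMatrix B}
    (cs : CoxeterSystem M W) (hsl : ∀ s t : B, s ≠ t → M s t = 2 ∨ M s t = 3) :
    Function.Injective cs.simple := by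
  classical
  intro a b hab
  by_contra hne
  have h := congrArg (cs.lift ⟨_, isLiftable_simplyLacedReflection hsl⟩) hab
  rw [cs.lift_apply_simple, cs.lift_apply_simple] at h
  have h' := congrFun (congrFun h (Pi.single a 1)) a
  simp [simplyLacedReflection, Ne.symm hne] at h'

theorem isUniqueReducedWord_singleton {B W : Type*} [Group W] {M : CoxeterMatrix B}
    (cs : CoxeterSystem M W) (hinj : Function.Injective cs.simple) (s : B) :
    IsUniqueReducedWord cs (cs.simple s) [s] := by
  refine ⟨cs.wordProd_singleton s, by simp [CoxeterSystem.IsReduced], fun ω hω hred => ?_⟩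
  have hlen : ω.length = 1 := by rw [← hred.eq, hω, cs.length_simple]
  obtain ⟨t, rfl⟩ := List.length_eq_one_iff.mp hlen
  rw [cs.wordProd_singleton] at hω
  rw [hinj hω]

section UniqueReducedWord

variable {B W : Type*} [Group W] {M : CoxeterMatrix B} {cs : CoxeterSystem M W} {w : W}
  {l₁ l₂ u v : List B} {a b : B}

/-- A factor of a unique reduced word is the only word of at most its length expressing the same
element. -/
theorem IsUniqueReducedWord.factor_eq_s2 (h : IsUniqueReducedWord cs w (l₁ ++ u ++ l₂))
    (hprod : cs.wordProd v = cs.wordProd u) (hlen : v.length ≤ u.length) : v = u := by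
  obtain ⟨hw, hred, huniq⟩ := h
  have hw' : cs.wordProd (l₁ ++ v ++ l₂) = w := by
    rw [← hw]
    simp only [cs.wordProd_append, hprod]
  have hred' : cs.IsReduced (l₁ ++ v ++ l₂) := by
    refine le_antisymm (cs.length_wordProd_le _) ?_
    rw [hw', ← hw, hred.eq]
    simp only [List.length_append]
    lia
  simpa using huniq _ hw' hred'

theorem IsUniqueReducedWord.ne_of_consecutive
    (h : IsUniqueReducedWord cs w (l₁ ++ [a, b] ++ l₂)) : a ≠ b := by
  rintro rfl
  have := h.factor_eq_s2 (v := []) (by simp [cs.wordProd_cons]) (by simp)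
  simp at this

theorem IsUniqueReducedWord.ne_two_of_consecutive
    (h : IsUniqueReducedWord cs w (l₁ ++ [a, b] ++ l₂)) : M a b ≠ 2 := by
  intro hM
  have hcomm : cs.simple b * cs.simple a = cs.simple a * cs.simple b := by
    have := cs.simple_mul_simple_pow a b
    rw [hM, pow_two, mul_eq_one_iff_eq_inv, mul_inv_rev, cs.inv_simple, cs.inv_simple] at this
    exact this.symm
  have := h.factor_eq_s2 (v := [b, a]) (by simpa [cs.wordProd_cons] using hcomm) (by simp)
  have hne := h.ne_of_consecutive
  simp_all

theorem IsUniqueReducedWord.ne_three_of_alternating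
    (h : IsUniqueReducedWord cs w (l₁ ++ [a, b, a] ++ l₂)) : M a b ≠ 3 := by
  intro hM
  have hbraid : cs.simple b * (cs.simple a * cs.simple b) =
      cs.simple a * (cs.simple b * cs.simple a) := by
    have := cs.simple_mul_simple_pow a b
    rw [hM, pow_succ, pow_two] at this
    have h2 : (cs.simple a * (cs.simple b * cs.simple a)) *
        (cs.simple b * (cs.simple a * cs.simple b)) = 1 := by
      simpa only [mul_assoc] using this
    rw [mul_eq_one_iff_eq_inv] at h2
    rw [h2]
    simp [mul_assoc]
  have := h.factor_eq_s2 (v := [b, a, b]) (by simpa [cs.wordProd_cons] using hbraid) (by simp)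
  have hne : a ≠ b := IsUniqueReducedWord.ne_of_consecutive (cs := cs) (w := w) (l₁ := l₁)
    (l₂ := a :: l₂) (by simpa using h)
  simp_all

end UniqueReducedWord

theorem SimpleGraph.Walk.isChain_ne_edges_of_support {V : Type*} {G : SimpleGraph V} {x y : V}
    (p : G.Walk x y) (h : ∀ l₁ l₂ a b, p.support ≠ l₁ ++ [a, b, a] ++ l₂) :
    p.edges.IsChain (· ≠ ·) := by
  induction p with
  | nil => simp
  | @cons u v _ huv q ih =>
    have hq := ih fun l₁ l₂ a b hl => h (u :: l₁) l₂ a b (by simp [hl])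
    cases q with
    | nil => simp
    | @cons _ z _ hvz r =>
      rw [edges_cons, edges_cons] at *
      refine List.isChain_cons_cons.mpr ⟨fun he => ?_, hq⟩
      have huz : u = z := by
        rw [Sym2.eq_swap] at he
        exact Sym2.congr_right.mp he
      subst huz
      apply h [] r.support.tail u v
      simp

/-- For a simply-laced Coxeter system whose Coxeter diagram (adjacency `m(s,t) = 3`) is a
forest, for every `s ∈ S` the set `Γ_s ∩ Γ_s⁻¹` is exactly `{s}`. -/
theorem gammaSet_eq_singleton_of_forest {M : CoxeterMatrix B} (cs : CoxeterSystem M W)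
    (hsl : ∀ s t : B, s ≠ t → M s t = 2 ∨ M s t = 3)
    (hforest : (SimpleGraph.fromRel (fun s t : B => M s t = 3)).IsAcyclic) :
    ∀ s : B, gammaSet cs s = {cs.simple s} := by
  intro s
  have hinj := simple_injective_of_simplyLaced cs hsl
  ext w
  constructor
  · rintro ⟨-, ω, hω, hhead, hlast⟩
    have hne : ω ≠ [] := by
      rintro rfl
      simp at hhead
    have hchain : ω.IsChain (SimpleGraph.fromRel (fun s t : B => M s t = 3)).Adj := by
      refine List.isChain_iff_forall_rel_of_append_cons_cons.mpr fun {a b l₁ l₂} hl => ?_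
      have hω' : IsUniqueReducedWord cs w (l₁ ++ [a, b] ++ l₂) := by simpa [← hl] using hω
      have hab := hω'.ne_of_consecutive
      exact ⟨hab, Or.inl ((hsl a b hab).resolve_left hω'.ne_two_of_consecutive)⟩
    have hpath : (SimpleGraph.Walk.ofSupport ω hne hchain).IsPath := by
      refine (hforest.isPath_iff_isChain _).mpr
        (SimpleGraph.Walk.isChain_ne_edges_of_support _ fun l₁ l₂ a b hl => ?_)
      rw [SimpleGraph.Walk.support_ofSupport] at hl
      subst hl
      have hω' : IsUniqueReducedWord cs w (l₁ ++ [a, b] ++ a :: l₂) := by simpa using hω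
      exact hω.ne_three_of_alternating
        ((hsl a b hω'.ne_of_consecutive).resolve_left hω'.ne_two_of_consecutive)
    have hnodup : ω.Nodup := by
      simpa [SimpleGraph.Walk.support_ofSupport] using hpath.support_nodup
    obtain ⟨l, rfl⟩ : ∃ l, ω = s :: l := List.head?_eq_some_iff.mp hhead
    rcases l.eq_nil_or_concat with rfl | ⟨l', b, rfl⟩
    · rw [Set.mem_singleton_iff, ← hω.1, cs.wordProd_singleton]
    · obtain rfl : b = s := by
        rw [List.concat_eq_append, ← List.cons_append, List.getLast?_concat] at hlast
        exact Option.some.inj hlast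
      simp at hnodup
  · rintro rfl
    refine ⟨fun h => ?_, [s], isUniqueReducedWord_singleton cs hinj s, rfl, rfl⟩
    simpa using (cs.length_simple s).symm.trans (congrArg cs.length h)
end

section
/- Let (W,S) be an irreducible Coxeter system with S finite, i.e., its Coxeter diagram G — the graph with vertex set S, an edge {s,t} whenever m(s,t) ≥ 3, the edge {s,t} carrying weight m(s,t) — is connected. Then the following are equivalent: (i) Γ_s ∩ Γ_s^{-1} is finite for some s ∈ S; (ii) Γ_s ∩ Γ_s^{-1} is finite for every s ∈ S; (iii) G is a tree, no edge of G has weight ∞, and at most one edge of G has weight greater than 3. -/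
variable {B : Type*} {W : Type*} [Group W]

namespace Subregular

open Real

section Geometric

variable (M : CoxeterMatrix B)

/-- The linear form `x ↦ 2 B(α_t, x)` of the geometric representation. -/
noncomputable def coroot (t : B) : (B →₀ ℝ) →ₗ[ℝ] ℝ :=
  Finsupp.linearCombination ℝ (fun s => -(2 * cos (π / M t s)))

/-- The reflection in the simple root `α_t` of the geometric representation. -/
noncomputable def refl (t : B) : Module.End ℝ (B →₀ ℝ) :=
  LinearMap.id - (coroot M t).smulRight (Finsupp.single t 1)

theorem refl_apply (t : B) (x : B →₀ ℝ) :
    refl M t x = x - coroot M t x • Finsupp.single t 1 := rfl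

theorem coroot_single (t s : B) :
    coroot M t (Finsupp.single s 1) = -(2 * cos (π / M t s)) := by
  simp [coroot]

theorem coroot_single_self (t : B) : coroot M t (Finsupp.single t 1) = 2 := by
  simp [coroot_single]

theorem refl_single_self (t : B) :
    refl M t (Finsupp.single t 1) = -Finsupp.single t 1 := by
  rw [refl_apply, coroot_single_self, two_smul]; abel

theorem refl_single (t s : B) :
    refl M t (Finsupp.single s 1) =
      Finsupp.single s 1 + (2 * cos (π / M t s)) • Finsupp.single t 1 := by
  rw [refl_apply, coroot_single, neg_smul, sub_neg_eq_add]

theorem refl_mul_self (t : B) : refl M t * refl M t = 1 := by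
  apply LinearMap.ext
  intro x
  simp only [Module.End.mul_apply, refl_apply M t x, map_sub, map_smul, refl_single_self,
    Module.End.one_apply]
  module

theorem refl_mul_refl_comb (s t : B) (x y : ℝ) :
    (refl M s * refl M t) (x • Finsupp.single s 1 + y • Finsupp.single t 1) =
      (2 * cos (π / M s t) * (2 * cos (π / M s t) * x - y) - x) • Finsupp.single s 1 +
      (2 * cos (π / M s t) * x - y) • Finsupp.single t 1 := by
  simp only [Module.End.mul_apply, map_add, map_smul, refl_single_self, refl_single,
    M.symmetric t s, map_neg]
  module

theorem refl_mul_refl_pow_comb (s t : B) (φ : ℝ) (n : ℕ) :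
    ((refl M s * refl M t) ^ n)
      (sin (φ + π / M s t) • Finsupp.single s 1 + sin φ • Finsupp.single t 1) =
      sin (φ + (2 * n + 1) * (π / M s t)) • Finsupp.single s 1 +
        sin (φ + 2 * n * (π / M s t)) • Finsupp.single t 1 := by
  induction n with
  | zero => simp
  | succ n ih =>
    rw [pow_succ', Module.End.mul_apply, ih, refl_mul_refl_comb]
    set θ := π / M s t
    have key : ∀ ψ : ℝ, 2 * cos θ * sin (ψ + θ) - sin ψ = sin (ψ + 2 * θ) := by
      intro ψ
      rw [sin_add, sin_add, sin_two_mul, cos_two_mul]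
      ring
    have h1 : 2 * cos θ * sin (φ + (2 * n + 1) * θ) - sin (φ + 2 * n * θ) =
        sin (φ + 2 * (n + 1 : ℕ) * θ) := by
      have := key (φ + 2 * n * θ)
      rw [show φ + 2 * n * θ + θ = φ + (2 * n + 1) * θ by ring] at this
      rw [this]; congr 1; push_cast; ring
    have h2 : 2 * cos θ * sin (φ + 2 * (n + 1 : ℕ) * θ) - sin (φ + (2 * n + 1) * θ) =
        sin (φ + (2 * (n + 1 : ℕ) + 1) * θ) := by
      have := key (φ + (2 * n + 1) * θ)
      rw [show φ + (2 * n + 1) * θ + θ = φ + 2 * (n + 1 : ℕ) * θ by push_cast; ring] at this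
      rw [this]; congr 1; push_cast; ring
    rw [h1, h2]

variable {M} in
theorem two_le_of_ne {s t : B} (hst : s ≠ t) (h0 : M s t ≠ 0) : 2 ≤ M s t := by
  have := M.off_diagonal s t hst
  omega

variable {M} in
theorem sin_pi_div_pos {s t : B} (hst : s ≠ t) (h0 : M s t ≠ 0) : 0 < sin (π / M s t) := by
  have h2 : (2 : ℝ) ≤ M s t := by exact_mod_cast two_le_of_ne hst h0
  apply sin_pos_of_pos_of_lt_pi
  · positivity
  · exact div_lt_self pi_pos (by linarith)

theorem refl_isLiftable : M.IsLiftable (refl M) := by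
  intro s t
  rcases eq_or_ne s t with rfl | hst
  · simp [refl_mul_self]
  by_cases h0 : M s t = 0
  · simp [h0]
  set θ := π / M s t with hθ
  have hsin : 0 < sin θ := sin_pi_div_pos hst h0
  have hM : (M s t : ℝ) * θ = π := by
    rw [hθ]; field_simp
  have fix : ∀ φ, ((refl M s * refl M t) ^ M s t)
      (sin (φ + θ) • Finsupp.single s 1 + sin φ • Finsupp.single t 1) =
      sin (φ + θ) • Finsupp.single s 1 + sin φ • Finsupp.single t 1 := by
    intro φ
    rw [refl_mul_refl_pow_comb, ← hθ,
      show φ + (2 * M s t + 1) * θ = φ + θ + 2 * π by linear_combination 2 * hM,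
      show φ + 2 * M s t * θ = φ + 2 * π by linear_combination 2 * hM, sin_add_two_pi,
      sin_add_two_pi]
  have fs : ((refl M s * refl M t) ^ M s t) (Finsupp.single s 1) = Finsupp.single s 1 := by
    have := fix 0
    simp only [zero_add, sin_zero, zero_smul, add_zero, map_smul] at this
    exact smul_right_injective _ hsin.ne' this
  have ft : ((refl M s * refl M t) ^ M s t) (Finsupp.single t 1) = Finsupp.single t 1 := by
    have := fix (-θ)
    simp only [neg_add_cancel, sin_zero, zero_smul, zero_add, map_smul, sin_neg] at this
    exact smul_right_injective _ (neg_ne_zero.2 hsin.ne') this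
  apply LinearMap.ext
  intro x
  have hdet : 4 * sin θ ^ 2 ≠ 0 := by positivity
  set a := 2 * cos θ with ha
  have hdet' : 4 - a ^ 2 = 4 * sin θ ^ 2 := by
    rw [ha]; linear_combination (-4) * sin_sq_add_cos_sq θ
  obtain ⟨u, v, hu, hv⟩ : ∃ u v : ℝ, coroot M s x = 2 * u - a * v ∧
      coroot M t x = 2 * v - a * u := by
    rw [← hdet'] at hdet
    refine ⟨(2 * coroot M s x + a * coroot M t x) / (4 - a ^ 2),
      (2 * coroot M t x + a * coroot M s x) / (4 - a ^ 2), ?_, ?_⟩ <;> field_simp <;> ring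
  obtain ⟨z, hz⟩ : ∃ z, x = z + (u • Finsupp.single s 1 + v • Finsupp.single t 1) :=
    ⟨x - (u • Finsupp.single s 1 + v • Finsupp.single t 1), by abel⟩
  have hzs : coroot M s z = 0 := by
    have := congrArg (coroot M s) hz
    simp only [map_add, map_smul, coroot_single_self, coroot_single, ← hθ, smul_eq_mul] at this
    linarith
  have hzt : coroot M t z = 0 := by
    have := congrArg (coroot M t) hz
    simp only [map_add, map_smul, coroot_single_self, coroot_single, M.symmetric t s, ← hθ,
      smul_eq_mul] at this
    linarith
  have hfz : ∀ n : ℕ, ((refl M s * refl M t) ^ n) z = z := by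
    intro n
    induction n with
    | zero => rfl
    | succ n ih =>
      rw [pow_succ, Module.End.mul_apply, Module.End.mul_apply, refl_apply M t, hzt, zero_smul,
        sub_zero, refl_apply M s, hzs, zero_smul, sub_zero, ih]
  rw [hz, map_add, map_add, map_smul, map_smul, fs, ft, hfz]
  rfl

end Geometric

variable {M : CoxeterMatrix B} (cs : CoxeterSystem M W)

/-- The geometric representation of a Coxeter group. -/
noncomputable def geomRep : W →* Module.End ℝ (B →₀ ℝ) :=
  cs.lift ⟨refl M, refl_isLiftable M⟩

theorem geomRep_simple (s : B) : geomRep cs (cs.simple s) = refl M s :=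
  cs.lift_apply_simple (refl_isLiftable M) s

theorem altWord_succ' (x y : B) (k : ℕ) :
    altWord x y (k + 1) = altWord x y k ++ [if Even k then x else y] := by
  induction k generalizing x y with
  | zero => simp [altWord]
  | succ k ih =>
    rw [altWord, ih y x, altWord, List.cons_append]
    simp only [Nat.even_add_one]
    split_ifs <;> rfl

theorem length_altWord (x y : B) (k : ℕ) : (altWord x y k).length = k := by
  induction k generalizing x y with
  | zero => rfl
  | succ k ih => simp [altWord, ih]

theorem getElem_altWord (x y : B) (k j : ℕ) (h : j < (altWord x y k).length) :
    (altWord x y k)[j] = if Even j then x else y := by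
  induction k generalizing x y j with
  | zero => simp [altWord] at h
  | succ k ih =>
    cases j with
    | zero => simp [altWord]
    | succ j =>
      simp only [altWord, List.getElem_cons_succ, ih, Nat.even_add_one]
      split_ifs <;> rfl

theorem alternatingWord_eq_altWord (x y : B) (k : ℕ) :
    CoxeterSystem.alternatingWord x y k = if Even k then altWord x y k else altWord y x k := by
  induction k with
  | zero => simp [CoxeterSystem.alternatingWord, altWord]
  | succ k ih =>
    rw [CoxeterSystem.alternatingWord_succ', ih]
    simp only [Nat.even_add_one]
    split_ifs <;> rfl

theorem wordProd_altWord_braid (x y : B) :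
    cs.wordProd (altWord x y (M x y)) = cs.wordProd (altWord y x (M x y)) := by
  have h := cs.wordProd_braidWord_eq x y
  simp only [CoxeterSystem.braidWord, alternatingWord_eq_altWord, M.symmetric y x] at h
  split_ifs at h
  · exact h
  · exact h.symm

theorem not_isReduced_altWord (x y : B) {m : ℕ} (hM : M x y ≠ 0) (hm : M x y < m) :
    ¬ cs.IsReduced (altWord x y m) := by
  have h1 := cs.not_isReduced_alternatingWord x y hM hm
  have h2 := cs.not_isReduced_alternatingWord y x (by rwa [M.symmetric y x])
    (by rwa [M.symmetric y x])
  rw [alternatingWord_eq_altWord] at h1 h2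
  split_ifs at h1 h2 <;> assumption

/-- The action of an alternating word on the simple root of the letter it does not end with. -/
theorem geomRep_altWord {x y : B} (k : ℕ) (hk : M x y = 0 ∨ k < M x y) (hxy : x ≠ y) :
    ∃ p q : ℝ, 0 ≤ p ∧ 0 ≤ q ∧
      geomRep cs (cs.wordProd (altWord x y k)) (Finsupp.single (if Even k then x else y) 1) =
        p • Finsupp.single x 1 + q • Finsupp.single y 1 := by
  set θ := π / M x y with hθ
  have step : ∀ (p : ℕ → ℝ), p 0 = 0 → p 1 = 1 →
      (∀ n, p (n + 2) = 2 * cos θ * p (n + 1) - p n) → ∀ (k : ℕ) (u v : B), M u v = M x y →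
      geomRep cs (cs.wordProd (altWord u v k)) (Finsupp.single (if Even k then u else v) 1) =
        p (k + 1) • Finsupp.single u 1 + p k • Finsupp.single v 1 := by
    intro p p0 p1 p2 k
    induction k with
    | zero => intro u v _; simp [altWord, p0, p1]
    | succ k ih =>
      intro u v huv
      have := ih v u (by rw [M.symmetric, huv])
      rw [altWord, cs.wordProd_cons, map_mul, Module.End.mul_apply, geomRep_simple]
      have he : (if Even (k + 1) then u else v) = if Even k then v else u := by
        simp only [Nat.even_add_one]; split_ifs <;> rfl
      rw [he, this, map_add, map_smul, map_smul, refl_single, refl_single_self, p2, huv]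
      module
  by_cases h0 : M x y = 0
  · refine ⟨(k + 1 : ℕ), k, by positivity, by positivity, ?_⟩
    refine step (fun n => n) (by simp) (by simp) (fun n => ?_) k x y rfl
    rw [hθ, h0]; push_cast; simp; ring
  · have hk : k < M x y := hk.resolve_left h0
    have hsin : 0 < sin θ := sin_pi_div_pos hxy h0
    have hM : (M x y : ℝ) * θ = π := by rw [hθ]; field_simp
    have hθ0 : 0 ≤ θ := by positivity
    have hpos : ∀ j : ℕ, j ≤ M x y → 0 ≤ sin (j * θ) / sin θ := by
      intro j hj
      refine div_nonneg (sin_nonneg_of_nonneg_of_le_pi (by positivity) ?_) hsin.le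
      rw [← hM]
      gcongr
    refine ⟨_, _, hpos (k + 1) hk, hpos k hk.le,
      step (fun n => sin (n * θ) / sin θ) (by simp) (by simp [hsin.ne']) (fun n => ?_) k x y rfl⟩
    have : sin ((n + 2 : ℕ) * θ) = 2 * cos θ * sin ((n + 1 : ℕ) * θ) - sin (n * θ) := by
      have h1 : ((n + 2 : ℕ) : ℝ) * θ = (n + 1 : ℕ) * θ + θ := by push_cast; ring
      have h2 : (n : ℝ) * θ = (n + 1 : ℕ) * θ - θ := by push_cast; ring
      rw [h1, h2, sin_add, sin_sub]; ring
    simp only [this]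
    field_simp

theorem geomRep_inv_apply (w : W) (x : B →₀ ℝ) : geomRep cs w⁻¹ (geomRep cs w x) = x := by
  rw [← Module.End.mul_apply, ← map_mul, inv_mul_cancel, map_one, Module.End.one_apply]

/-- Splitting off a maximal alternating suffix in two letters. -/
theorem exists_dihedral_suffix {s t : B} (hst : s ≠ t) (w : W) :
    ∃ (v : W) (x y : B) (k : ℕ), ((x = s ∧ y = t) ∨ (x = t ∧ y = s)) ∧
      w = v * cs.wordProd (altWord x y k) ∧ cs.length v + k = cs.length w ∧
      ¬ cs.IsRightDescent v s ∧ ¬ cs.IsRightDescent v t := by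
  have main : ∀ (n : ℕ) (v : W) (x y : B) (k : ℕ), cs.length v = n →
      ((x = s ∧ y = t) ∨ (x = t ∧ y = s)) → w = v * cs.wordProd (altWord x y k) →
      cs.length v + k = cs.length w →
      ∃ (v : W) (x y : B) (k : ℕ), ((x = s ∧ y = t) ∨ (x = t ∧ y = s)) ∧
      w = v * cs.wordProd (altWord x y k) ∧ cs.length v + k = cs.length w ∧
      ¬ cs.IsRightDescent v s ∧ ¬ cs.IsRightDescent v t := by
    intro n
    induction n using Nat.strong_induction_on with
    | _ n ih =>
      intro v x y k hn hxy hw hl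
      by_cases hd : ¬ cs.IsRightDescent v s ∧ ¬ cs.IsRightDescent v t
      · exact ⟨v, x, y, k, hxy, hw, hl, hd⟩
      -- A descent of `v` in `{s, t}` either lengthens the suffix or shortens the whole word.
      have key : ∀ x y : B, ((x = s ∧ y = t) ∨ (x = t ∧ y = s)) →
          w = v * cs.wordProd (altWord x y k) → cs.IsRightDescent v y →
          ∃ (v : W) (x y : B) (k : ℕ), ((x = s ∧ y = t) ∨ (x = t ∧ y = s)) ∧
            w = v * cs.wordProd (altWord x y k) ∧ cs.length v + k = cs.length w ∧
            ¬ cs.IsRightDescent v s ∧ ¬ cs.IsRightDescent v t := by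
        intro x y hxy hw hy
        have hlen := cs.isRightDescent_iff.1 hy
        refine ih (cs.length (v * cs.simple y)) (by omega) (v * cs.simple y) y x (k + 1) rfl
          (hxy.symm.imp And.symm And.symm) ?_ (by omega)
        rw [altWord, cs.wordProd_cons, mul_assoc, cs.simple_mul_simple_cancel_left, hw]
      have hd' : cs.IsRightDescent v x ∨ cs.IsRightDescent v y := by
        rcases hxy with ⟨rfl, rfl⟩ | ⟨rfl, rfl⟩ <;> tauto
      rcases hd' with hx | hy
      · cases k with
        | zero =>
          exact key y x (hxy.symm.imp And.symm And.symm) (by simpa [altWord] using hw) hx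
        | succ k =>
          exfalso
          have hlen := cs.isRightDescent_iff.1 hx
          have h1 : w = (v * cs.simple x) * cs.wordProd (altWord y x k) := by
            rw [hw, altWord, cs.wordProd_cons, mul_assoc]
          have h2 := cs.length_mul_le (v * cs.simple x) (cs.wordProd (altWord y x k))
          have h3 := cs.length_wordProd_le (altWord y x k)
          rw [← h1] at h2
          rw [length_altWord] at h3
          omega
      · exact key x y hxy hw hy
  exact main _ w s t 0 rfl (Or.inl ⟨rfl, rfl⟩) (by simp [altWord]) rfl

theorem altWord_not_longer {v w : W} {x y : B} {k : ℕ} (hM : M x y ≠ 0)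
    (hw : w = v * cs.wordProd (altWord x y k)) (hl : cs.length v + k = cs.length w) :
    k ≤ M x y := by
  by_contra hk
  push Not at hk
  apply not_isReduced_altWord cs x y hM hk
  have h2 := cs.length_mul_le v (cs.wordProd (altWord x y k))
  have h3 := cs.length_wordProd_le (altWord x y k)
  rw [← hw] at h2
  rw [length_altWord] at h3
  unfold CoxeterSystem.IsReduced
  rw [length_altWord]
  omega

/-- A simple root is sent to a nonnegative combination of simple roots by every element which
does not have the corresponding simple reflection as a right descent. -/
theorem geomRep_nonneg (w : W) (s : B) (hs : ¬ cs.IsRightDescent w s) :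
    0 ≤ geomRep cs w (Finsupp.single s 1) := by
  induction hn : cs.length w using Nat.strong_induction_on generalizing w s with
  | _ n ih =>
  by_cases h1 : w = 1
  · subst h1
    rw [map_one, Module.End.one_apply]
    exact Finsupp.single_nonneg.2 zero_le_one
  obtain ⟨t, ht⟩ := cs.exists_rightDescent_of_ne_one h1
  have hst : s ≠ t := by rintro rfl; exact hs ht
  obtain ⟨v, x, y, k, hxy, hw, hl, hvs, hvt⟩ := exists_dihedral_suffix cs hst w
  have hxy_ne : x ≠ y := by rcases hxy with ⟨rfl, rfl⟩ | ⟨rfl, rfl⟩; exacts [hst, hst.symm]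
  have hvx : ¬ cs.IsRightDescent v x ∧ ¬ cs.IsRightDescent v y := by
    rcases hxy with ⟨rfl, rfl⟩ | ⟨rfl, rfl⟩; exacts [⟨hvs, hvt⟩, ⟨hvt, hvs⟩]
  obtain _ | k := k
  · simp only [altWord, cs.wordProd_nil, mul_one] at hw
    subst hw
    exact absurd ht hvt
  -- The last letter of the suffix is a descent of `w`.
  have hlast : cs.IsRightDescent w (if Even k then x else y) := by
    rw [altWord_succ', cs.wordProd_append, cs.wordProd_singleton, ← mul_assoc] at hw
    have h4 := cs.length_mul_le v (cs.wordProd (altWord x y k))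
    have h3 := cs.length_wordProd_le (altWord x y k)
    rw [length_altWord] at h3
    unfold CoxeterSystem.IsRightDescent
    rw [hw, cs.simple_mul_simple_cancel_right, ← hw]
    omega
  have hs_eq : s = if Even (k + 1) then x else y := by
    simp only [Nat.even_add_one]
    by_cases he : Even k
    · simp only [he, if_true, not_true, if_false] at hlast ⊢
      rcases hxy with ⟨rfl, rfl⟩ | ⟨rfl, rfl⟩
      exacts [absurd hlast hs, rfl]
    · simp only [he, if_false, not_false_iff, if_true] at hlast ⊢
      rcases hxy with ⟨rfl, rfl⟩ | ⟨rfl, rfl⟩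
      exacts [rfl, absurd hlast hs]
  have hk : M x y = 0 ∨ k + 1 < M x y := by
    by_contra! hk
    have hlen := cs.not_isRightDescent_iff.1 hs
    have : w * cs.simple s = v * cs.wordProd (altWord x y (k + 1 + 1)) := by
      rw [altWord_succ', cs.wordProd_append, cs.wordProd_singleton, ← hs_eq, ← mul_assoc, hw]
    have := altWord_not_longer cs hk.1 this (by omega)
    omega
  obtain ⟨p, q, hp, hq, hpq⟩ := geomRep_altWord cs (k + 1) hk hxy_ne
  rw [hw, map_mul, Module.End.mul_apply, hs_eq, hpq, map_add, map_smul, map_smul]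
  exact add_nonneg (smul_nonneg hp (ih _ (by omega) v x hvx.1 rfl))
    (smul_nonneg hq (ih _ (by omega) v y hvx.2 rfl))

/-- An element with two distinct right descents has a reduced word ending in a braid. -/
theorem exists_braid_suffix {s t : B} (hst : s ≠ t) {w : W} (hs : cs.IsRightDescent w s)
    (ht : cs.IsRightDescent w t) :
    M s t ≠ 0 ∧ ∃ v : W, w = v * cs.wordProd (altWord s t (M s t)) ∧
      cs.length v + M s t = cs.length w := by
  obtain ⟨v, x, y, k, hxy, hw, hl, hvs, hvt⟩ := exists_dihedral_suffix cs hst w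
  have hxy_ne : x ≠ y := by rcases hxy with ⟨rfl, rfl⟩ | ⟨rfl, rfl⟩; exacts [hst, hst.symm]
  have hvx : ¬ cs.IsRightDescent v x ∧ ¬ cs.IsRightDescent v y := by
    rcases hxy with ⟨rfl, rfl⟩ | ⟨rfl, rfl⟩; exacts [⟨hvs, hvt⟩, ⟨hvt, hvs⟩]
  have hz : cs.IsRightDescent w (if Even k then x else y) := by
    rcases hxy with ⟨rfl, rfl⟩ | ⟨rfl, rfl⟩ <;> split_ifs <;> assumption
  have hk : ¬ (M x y = 0 ∨ k < M x y) := by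
    intro hk
    obtain ⟨p, q, hp, hq, hpq⟩ := geomRep_altWord cs k hk hxy_ne
    set z := if Even k then x else y
    have h1 : 0 ≤ geomRep cs w (Finsupp.single z 1) := by
      rw [hw, map_mul, Module.End.mul_apply, hpq, map_add, map_smul, map_smul]
      exact add_nonneg (smul_nonneg hp (geomRep_nonneg cs v x hvx.1))
        (smul_nonneg hq (geomRep_nonneg cs v y hvx.2))
    have h2 := geomRep_nonneg cs (w * cs.simple z) z
      (cs.isRightDescent_iff_not_isRightDescent_mul.1 hz)
    rw [map_mul, Module.End.mul_apply, geomRep_simple, refl_single_self, map_neg,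
      Left.nonneg_neg_iff] at h2
    have h3 := geomRep_inv_apply cs w (Finsupp.single z 1)
    rw [le_antisymm h2 h1, map_zero] at h3
    exact one_ne_zero (Finsupp.single_eq_zero.1 h3.symm)
  push Not at hk
  have hkM : k = M x y := le_antisymm (altWord_not_longer cs hk.1 hw hl) hk.2
  subst hkM
  rcases hxy with ⟨rfl, rfl⟩ | ⟨rfl, rfl⟩
  · exact ⟨hk.1, v, hw, hl⟩
  · rw [M.symmetric y x]
    exact ⟨hk.1, v, by rw [hw, wordProd_altWord_braid], hl⟩

/-- A word with no two equal adjacent letters and no factor which is one side of a braid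
relation. -/
def IsRigid (M : CoxeterMatrix B) (ω : List B) : Prop :=
  ω.IsChain (· ≠ ·) ∧ ∀ s t : B, s ≠ t → M s t ≠ 0 → ¬ altWord s t (M s t) <:+: ω

theorem IsRigid.of_isInfix {ω ω' : List B} (h : IsRigid M ω) (h' : ω' <:+: ω) : IsRigid M ω' :=
  ⟨h.1.infix h', fun s t hst h0 hi => h.2 s t hst h0 (hi.trans h')⟩

theorem IsRigid.isReduced_and_unique {ω : List B} (h : IsRigid M ω) :
    cs.IsReduced ω ∧ ∀ ω' : List B, cs.wordProd ω' = cs.wordProd ω → cs.IsReduced ω' →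
      ω' = ω := by
  induction ω using List.reverseRecOn with
  | nil =>
    refine ⟨by simp [CoxeterSystem.IsReduced], fun ω' h1 h2 => ?_⟩
    unfold CoxeterSystem.IsReduced at h2
    rw [h1] at h2
    simpa using h2.symm
  | append_singleton ω s ih =>
    obtain ⟨hred, huniq⟩ := ih (h.of_isInfix (List.infix_append' [] ω [s]))
    have hprod : cs.wordProd (ω ++ [s]) = cs.wordProd ω * cs.simple s := by
      rw [cs.wordProd_append, cs.wordProd_singleton]
    have hnd : ¬ cs.IsRightDescent (cs.wordProd ω) s := by
      intro hd
      obtain ⟨υ, hυ, hυw⟩ := cs.exists_isReduced (cs.wordProd ω * cs.simple s)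
      have hlen := cs.isRightDescent_iff.1 hd
      have heq : cs.wordProd (υ ++ [s]) = cs.wordProd ω := by
        rw [cs.wordProd_append, cs.wordProd_singleton, ← hυw,
          cs.simple_mul_simple_cancel_right]
      have := huniq (υ ++ [s]) heq (by
        have := hυ.eq
        rw [← hυw] at this
        unfold CoxeterSystem.IsReduced
        rw [heq, List.length_append, List.length_singleton]
        omega)
      rw [← this] at h
      have hc := h.1
      rw [List.append_assoc] at hc
      have := hc.infix (List.suffix_append υ [s, s]).isInfix
      simp at this
    have hlen := cs.not_isRightDescent_iff.1 hnd
    have hred' : cs.IsReduced (ω ++ [s]) := by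
      unfold CoxeterSystem.IsReduced
      rw [hprod, hlen, hred.eq, List.length_append, List.length_singleton]
    refine ⟨hred', fun ω' h1 h2 => ?_⟩
    rcases List.eq_nil_or_concat ω' with rfl | ⟨υ, t, rfl⟩
    · exfalso
      have := hred'.eq
      rw [← h1] at this
      simp at this
    rw [List.concat_eq_append] at h1 h2 ⊢
    have hυ : cs.IsReduced υ := by simpa using h2.take υ.length
    have hυ1 : cs.wordProd (υ ++ [t]) = cs.wordProd υ * cs.simple t := by
      rw [cs.wordProd_append, cs.wordProd_singleton]
    by_cases hts : t = s
    · subst hts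
      rw [huniq υ (by rw [hυ1, hprod] at h1; exact mul_right_cancel h1) hυ]
    exfalso
    set w := cs.wordProd (ω ++ [s]) with hwdef
    have hds : cs.IsRightDescent w s := by
      unfold CoxeterSystem.IsRightDescent
      rw [hprod, cs.simple_mul_simple_cancel_right, hlen]
      omega
    have hdt : cs.IsRightDescent w t := by
      unfold CoxeterSystem.IsRightDescent
      have := h2.eq
      rw [h1] at this
      rw [← h1, hυ1, cs.simple_mul_simple_cancel_right, ← hυ1, h1, this, hυ.eq]
      simp
    obtain ⟨x, y, ⟨hne, hM0, hlast⟩, u, hu, hul⟩ : ∃ x y : B, (x ≠ y ∧ M x y ≠ 0 ∧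
        s = if Even (M x y - 1) then x else y) ∧ ∃ v : W,
        w = v * cs.wordProd (altWord x y (M x y)) ∧ cs.length v + M x y = cs.length w := by
      by_cases he : Even (M s t - 1)
      · obtain ⟨h0, v, hv⟩ := exists_braid_suffix cs (Ne.symm hts) hds hdt
        exact ⟨s, t, ⟨Ne.symm hts, h0, by simp [he]⟩, v, hv⟩
      · obtain ⟨h0, v, hv⟩ := exists_braid_suffix cs hts hdt hds
        exact ⟨t, s, ⟨hts, h0, by rw [M.symmetric t s]; simp [he]⟩, v, hv⟩
    have hm := two_le_of_ne hne hM0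
    obtain ⟨ν, hν, rfl⟩ := cs.exists_isReduced u
    have hsplit : altWord x y (M x y) = altWord x y (M x y - 1) ++ [s] := by
      conv_lhs => rw [show M x y = M x y - 1 + 1 by omega]
      rw [altWord_succ', ← hlast]
    have hprod' : cs.wordProd (ν ++ altWord x y (M x y - 1)) = cs.wordProd ω := by
      rw [hprod, hsplit, cs.wordProd_append, cs.wordProd_singleton, ← mul_assoc] at hu
      rw [cs.wordProd_append]
      exact (mul_right_cancel hu).symm
    have := huniq _ hprod' (by
      unfold CoxeterSystem.IsReduced
      rw [hprod', List.length_append, length_altWord, ← hν.eq]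
      rw [hprod] at hul
      omega)
    refine h.2 x y hne hM0 ⟨ν, [], ?_⟩
    rw [← this, hsplit]
    simp

theorem IsRigid.of_unique {ω : List B} (hred : cs.IsReduced ω)
    (huniq : ∀ ω' : List B, cs.wordProd ω' = cs.wordProd ω → cs.IsReduced ω' → ω' = ω) :
    IsRigid M ω := by
  constructor
  · rw [List.isChain_iff_forall_rel_of_append_cons_cons]
    rintro s t l₁ l₂ rfl rfl
    have h1 : cs.wordProd (l₁ ++ s :: s :: l₂) = cs.wordProd (l₁ ++ l₂) := by
      simp [cs.wordProd_append, cs.wordProd_cons]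
    have h2 := cs.length_wordProd_le (l₁ ++ l₂)
    rw [← h1, hred.eq] at h2
    simp at h2
  · rintro s t hst h0 ⟨l₁, l₂, rfl⟩
    have h1 : cs.wordProd (l₁ ++ altWord t s (M s t) ++ l₂) =
        cs.wordProd (l₁ ++ altWord s t (M s t) ++ l₂) := by
      simp only [cs.wordProd_append, wordProd_altWord_braid cs s t]
    have h2 := huniq _ h1 (by
      unfold CoxeterSystem.IsReduced
      rw [h1, hred.eq]
      simp [length_altWord])
    rw [List.append_left_inj, List.append_right_inj] at h2
    obtain ⟨m, hm⟩ := Nat.exists_eq_succ_of_ne_zero h0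
    rw [hm] at h2
    simp only [altWord, List.cons.injEq] at h2
    exact hst h2.1.symm

theorem isUniqueReducedWord_iff {w : W} {ω : List B} :
    IsUniqueReducedWord cs w ω ↔ cs.wordProd ω = w ∧ IsRigid M ω := by
  constructor
  · rintro ⟨rfl, h1, h2⟩
    exact ⟨rfl, .of_unique cs h1 h2⟩
  · rintro ⟨rfl, h⟩
    exact ⟨rfl, h.isReduced_and_unique cs⟩

/-- The Coxeter diagram. -/
abbrev diagram (M : CoxeterMatrix B) : SimpleGraph B :=
  SimpleGraph.fromRel (fun s t : B => M s t = 0 ∨ 3 ≤ M s t)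

theorem diagram_adj {s t : B} : (diagram M).Adj s t ↔ s ≠ t ∧ (M s t = 0 ∨ 3 ≤ M s t) := by
  rw [SimpleGraph.fromRel_adj, M.symmetric t s, or_self]

theorem not_isRigid_of_getD {ω : List B} {d s t : B} (i : ℕ) (hst : s ≠ t) (h0 : M s t ≠ 0)
    (hi : i + M s t ≤ ω.length)
    (h : ∀ j < M s t, ω.getD (i + j) d = if Even j then s else t) : ¬ IsRigid M ω := by
  intro hr
  refine hr.2 s t hst h0 ?_
  have : altWord s t (M s t) = (ω.drop i).take (M s t) := by
    apply List.ext_getElem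
    · simp only [length_altWord, List.length_take, List.length_drop]
      omega
    · intro j h1 h2
      rw [length_altWord] at h1
      rw [getElem_altWord, ← h j h1, List.getElem_take, List.getElem_drop, List.getD_eq_getElem]
  rw [this]
  exact (List.take_prefix _ _).isInfix.trans (List.drop_suffix _ _).isInfix

theorem isRigid_map_range {f : ℕ → B} (hadj : ∀ i, (diagram M).Adj (f i) (f (i + 1)))
    (hback : ∀ i, f i = f (i + 2) →
      M (f i) (f (i + 1)) = 0 ∨ (3 < M (f i) (f (i + 1)) ∧ f (i + 1) ≠ f (i + 3))) (n : ℕ) :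
    IsRigid M ((List.range n).map f) := by
  constructor
  · rw [List.isChain_iff_getElem]
    intro i hi
    simpa using (hadj i).ne
  · rintro s t hst h0 ⟨l₁, l₂, h⟩
    have h2 := two_le_of_ne hst h0
    have key : ∀ j < M s t, f (l₁.length + j) = if Even j then s else t := by
      intro j hj
      have hlen := congrArg List.length h
      simp only [List.length_append, length_altWord, List.length_map, List.length_range] at hlen
      have h1 : ((List.range n).map f)[l₁.length + j]? = some (f (l₁.length + j)) := by
        rw [List.getElem?_map, List.getElem?_range (by omega)]
        rfl
      rw [← h, List.append_assoc, List.getElem?_append_right (by omega),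
        List.getElem?_append_left (by rw [length_altWord]; omega), Nat.add_sub_cancel_left,
        List.getElem?_eq_getElem (by rwa [length_altWord]), getElem_altWord] at h1
      exact (Option.some_injective _ h1).symm
    set i := l₁.length
    have k0 : f i = s := by simpa using key 0 (by omega)
    have k1 : f (i + 1) = t := by simpa using key 1 (by omega)
    have h3 : 3 ≤ M s t := by
      have := (diagram_adj.1 (hadj i)).2
      rw [k0, k1] at this
      exact this.resolve_left h0
    have k2 : f (i + 2) = s := by simpa using key 2 (by omega)
    have hb := hback i (by rw [k0, k2])
    rw [k0, k1] at hb
    obtain ⟨h4, h5⟩ := hb.resolve_left h0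
    have k3 : f (i + 3) = t := by simpa [show ¬ Even 3 by decide] using key 3 h4
    exact h5 k3.symm

theorem IsRigid.reverse {ω : List B} (h : IsRigid M ω) : IsRigid M ω.reverse := by
  constructor
  · rw [List.isChain_reverse]
    exact h.1.imp fun _ _ => Ne.symm
  · intro s t hst h0 hi
    rw [← List.reverse_infix, List.reverse_reverse] at hi
    have hrev : ∀ (k : ℕ) (x y : B), (altWord x y k).reverse =
        if Even k then altWord y x k else altWord x y k := by
      intro k
      induction k with
      | zero => simp [altWord]
      | succ k ih =>
        intro x y
        conv_lhs => rw [altWord_succ', List.reverse_append, ih]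
        simp only [Nat.even_add_one]
        split_ifs <;> rfl
    rw [hrev] at hi
    split_ifs at hi
    · exact h.2 t s hst.symm (by rwa [M.symmetric t s]) (by rwa [M.symmetric t s])
    · exact h.2 s t hst h0 hi

/-- There are arbitrarily long rigid words from `s` to `t`. -/
def HasLongWords (M : CoxeterMatrix B) (s t : B) : Prop :=
  ∀ N : ℕ, ∃ ω : List B, IsRigid M ω ∧ ω.head? = some s ∧ ω.getLast? = some t ∧ N ≤ ω.length

theorem HasLongWords.symm {s t : B} (h : HasLongWords M s t) : HasLongWords M t s := by
  intro N
  obtain ⟨ω, h1, h2, h3, h4⟩ := h N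
  exact ⟨ω.reverse, h1.reverse, by simpa using h3, by simpa using h2, by simpa using h4⟩

theorem HasLongWords.of_adj {s x t : B} (hsx : (diagram M).Adj s x) (h : HasLongWords M x t) :
    HasLongWords M s t := by
  intro N
  obtain ⟨ω, h1, h2, h3, h4⟩ := h (N + 2)
  obtain ⟨l, y, rfl⟩ : ∃ l y, ω = x :: y :: l := by
    match ω, h2, h4 with
    | a :: b :: l, h2, _ => exact ⟨l, b, by simpa using h2⟩
  by_cases hy : y = s
  · subst hy
    refine ⟨y :: l, h1.of_isInfix (List.suffix_cons x _).isInfix, rfl, by simpa using h3, ?_⟩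
    simp only [List.length_cons] at h4 ⊢
    omega
  · refine ⟨s :: x :: y :: l, ⟨?_, ?_⟩, rfl, by simpa using h3, ?_⟩
    · exact List.IsChain.cons_cons hsx.ne h1.1
    · intro p q hpq h0 hi
      rw [List.infix_cons_iff] at hi
      refine hi.elim (fun hi => ?_) (h1.2 p q hpq h0)
      obtain ⟨m, hm⟩ : ∃ m, M p q = m + 2 := ⟨M p q - 2, by have := two_le_of_ne hpq h0; omega⟩
      have h3 := (diagram_adj.1 hsx).2
      rw [hm] at hi
      simp only [altWord, List.cons_prefix_cons] at hi
      obtain ⟨rfl, rfl, hi⟩ := hi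
      obtain ⟨k, rfl⟩ : ∃ k, m = k + 1 := ⟨m - 1, by omega⟩
      simp only [altWord, List.cons_prefix_cons] at hi
      exact hy hi.1.symm
    · simp only [List.length_cons] at h4 ⊢
      omega

theorem HasLongWords.of_reachable {s x t : B} (hsx : (diagram M).Reachable s x)
    (h : HasLongWords M x t) : HasLongWords M s t := by
  obtain ⟨p⟩ := hsx
  induction p with
  | nil => exact h
  | cons hadj _ ih => exact (ih h).of_adj hadj

theorem HasLongWords.infinite {s : B} (h : HasLongWords M s s) : (gammaSet cs s).Infinite := by
  intro hfin
  obtain ⟨K, hK⟩ := (hfin.image cs.length).bddAbove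
  obtain ⟨ω, h1, h2, h3, h4⟩ := h (K + 1)
  have hu := (isUniqueReducedWord_iff cs).2 ⟨rfl, h1⟩
  have hlen : cs.length (cs.wordProd ω) = ω.length := hu.2.1
  have hmem : cs.wordProd ω ∈ gammaSet cs s := by
    refine ⟨fun hw => ?_, ω, hu, h2, h3⟩
    rw [← cs.length_eq_zero_iff, hlen] at hw
    omega
  have := hK ⟨_, hmem, rfl⟩
  omega

theorem gammaSet_finite_of_bounded [Finite B] {K : ℕ}
    (hK : ∀ ω : List B, IsRigid M ω → ω.length ≤ K) (s : B) : (gammaSet cs s).Finite := by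
  refine ((List.finite_length_le B K).image cs.wordProd).subset ?_
  rintro w ⟨-, ω, hω, -⟩
  obtain ⟨rfl, h⟩ := (isUniqueReducedWord_iff cs).1 hω
  exact ⟨ω, hK ω h, rfl⟩

/-- An infinite rigid sequence makes every `Γ_s ∩ Γ_s⁻¹` infinite. -/
theorem gammaSet_infinite_of_seq [Finite B] (hconn : (diagram M).Connected) {f : ℕ → B}
    (hadj : ∀ i, (diagram M).Adj (f i) (f (i + 1)))
    (hback : ∀ i, f i = f (i + 2) →
      M (f i) (f (i + 1)) = 0 ∨ (3 < M (f i) (f (i + 1)) ∧ f (i + 1) ≠ f (i + 3))) (s : B) :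
    (gammaSet cs s).Infinite := by
  cases nonempty_fintype B
  obtain ⟨t, ht⟩ : ∃ t, HasLongWords M (f 0) t := by
    by_contra! hno
    simp only [HasLongWords] at hno
    push Not at hno
    choose N hN using hno
    have := hN (f (∑ y, N y)) _ (isRigid_map_range hadj hback (∑ y, N y + 1))
      (by simp [List.range_succ_eq_map]) (by simp [List.range_succ])
    have h2 := Finset.single_le_sum (f := N) (fun _ _ => Nat.zero_le _)
      (Finset.mem_univ (f (∑ y, N y)))
    simp only [List.length_map, List.length_range] at this
    omega
  refine HasLongWords.infinite cs ?_
  exact (ht.of_reachable (hconn.preconnected s (f 0))).symm.of_reachable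
    (hconn.preconnected s t)

/-- A walk without backtracking in an acyclic graph does not return to its start. -/
theorem ne_of_isAcyclic {G : SimpleGraph B} (hG : G.IsAcyclic) {f : ℕ → B} {n : ℕ}
    (hadj : ∀ i < n, G.Adj (f i) (f (i + 1))) (hback : ∀ i, i + 2 ≤ n → f i ≠ f (i + 2))
    (hn : 0 < n) : f 0 ≠ f n := by
  have walk : ∀ m ≤ n, ∃ p : G.Walk (f 0) (f m),
      p.edges = (List.range m).map (fun i => s(f i, f (i + 1))) := by
    intro m
    induction m with
    | zero => exact fun _ => ⟨.nil, rfl⟩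
    | succ m ih =>
      intro hm
      obtain ⟨p, hp⟩ := ih (by omega)
      refine ⟨p.concat (hadj m hm), ?_⟩
      rw [SimpleGraph.Walk.edges_concat, hp, List.range_succ, List.map_append]
      simp
  obtain ⟨p, hp⟩ := walk n le_rfl
  have hlen : p.length = n := by
    rw [← SimpleGraph.Walk.length_edges, hp]
    simp
  have hpath : p.IsPath := by
    rw [hG.isPath_iff_isChain, hp, List.isChain_iff_getElem]
    intro i hi heq
    simp only [List.length_map, List.length_range] at hi
    simp only [List.getElem_map, List.getElem_range] at heq
    rcases Sym2.eq_iff.1 heq with ⟨h1, -⟩ | ⟨h1, -⟩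
    · exact (hadj i (by omega)).ne h1
    · exact hback i (by omega) h1
  intro h0
  have hend := p.getVert_length
  rw [hlen] at hend
  have := hpath.getVert_injOn (x₁ := 0) (x₂ := n) (Nat.zero_le _) hlen.ge
    (p.getVert_zero.trans (h0.trans hend.symm))
  omega

/-- In a finite diagram which is a tree with finite weights and at most one weight above `3`,
rigid words have bounded length. -/
theorem exists_bound_of_tree [Finite B] (hG : (diagram M).IsAcyclic)
    (hfin : ∀ s t : B, s ≠ t → M s t ≠ 0)
    (hheavy : ∀ s t u v : B, s ≠ t → u ≠ v → 3 < M s t → 3 < M u v →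
      ((s = u ∧ t = v) ∨ (s = v ∧ t = u))) :
    ∃ K, ∀ ω : List B, IsRigid M ω → ω.length ≤ K := by
  cases nonempty_fintype B
  set N := Fintype.card B with hN
  set S := ∑ p : B × B, M p.1 p.2 with hS
  have hMS : ∀ s t : B, M s t ≤ S := fun s t =>
    Finset.single_le_sum (f := fun p : B × B => M p.1 p.2) (fun _ _ => Nat.zero_le _)
      (Finset.mem_univ (s, t))
  refine ⟨2 * N + S + 10, fun ω hω => ?_⟩
  by_contra! hL
  set L := ω.length
  obtain ⟨d⟩ : Nonempty B := by
    cases ω with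
    | nil => simp [L] at hL
    | cons a _ => exact ⟨a⟩
  set f : ℕ → B := fun i => ω.getD i d with hf
  have hne : ∀ i, i + 1 < L → f i ≠ f (i + 1) := by
    intro i hi
    have := List.isChain_iff_getElem.1 hω.1 i hi
    rwa [← List.getD_eq_getElem (d := d), ← List.getD_eq_getElem (d := d)] at this
  have hadj : ∀ i, i + 1 < L → (diagram M).Adj (f i) (f (i + 1)) := by
    intro i hi
    refine diagram_adj.2 ⟨hne i hi, Or.inr ?_⟩
    by_contra hlt
    have h2 : M (f i) (f (i + 1)) = 2 := by
      have := two_le_of_ne (hne i hi) (hfin _ _ (hne i hi))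
      omega
    refine not_isRigid_of_getD (d := d) i (hne i hi) (hfin _ _ (hne i hi)) (by omega) ?_ hω
    intro j hj
    rw [h2] at hj
    interval_cases j <;> simp [hf]
  have hback : ∀ i, i + 2 < L → f i = f (i + 2) → 3 < M (f i) (f (i + 1)) := by
    intro i hi h
    have hni := hne i (by omega)
    by_contra hlt
    have h3 : M (f i) (f (i + 1)) = 3 := by
      have := (diagram_adj.1 (hadj i (by omega))).2.resolve_left (hfin _ _ hni)
      omega
    refine not_isRigid_of_getD (d := d) i hni (hfin _ _ hni) (by omega) ?_ hω
    intro j hj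
    rw [h3] at hj
    interval_cases j
    · simp [hf]
    · simp [hf]
    · simpa [hf] using h.symm
  -- Absence of backtracking in an interval forces the letters there to be distinct.
  have hdist : ∀ a b, a < b → b < L → (∀ j, a ≤ j → j + 2 ≤ b → f j ≠ f (j + 2)) →
      f a ≠ f b := by
    intro a b hab hb hnb
    have := ne_of_isAcyclic hG (f := fun i => f (a + i)) (n := b - a)
      (fun i hi => hadj (a + i) (by omega)) (fun i hi => hnb (a + i) (by omega) (by omega))
      (by omega)
    simpa [Nat.add_sub_cancel' hab.le] using this
  have hwin : ∀ i, i + N < L → ∃ j, i ≤ j ∧ j + 2 ≤ i + N ∧ f j = f (j + 2) := by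
    intro i hi
    by_contra! hno
    have hinj : Function.Injective (fun k : Fin (N + 1) => f (i + k)) := by
      have hlt : ∀ k l : Fin (N + 1), k < l → f (i + k) ≠ f (i + l) := fun k l hkl =>
        hdist (i + k) (i + l) (by have : (k : ℕ) < l := hkl; omega) (by omega)
          (fun j hj1 hj2 => hno j (by omega) (by omega))
      intro k l hkl
      rcases lt_trichotomy k l with h | h | h
      · exact absurd hkl (hlt k l h)
      · exact h
      · exact absurd hkl.symm (hlt l k h)
    have := Fintype.card_le_of_injective _ hinj
    rw [Fintype.card_fin] at this
    omega
  have hnext : ∀ i, i + 1 + N < L → f i = f (i + 2) → f (i + 1) = f (i + 3) := by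
    classical
    intro i hi hbi
    have hex : ∃ j, i + 1 ≤ j ∧ j + 2 ≤ i + 1 + N ∧ f j = f (j + 2) := hwin (i + 1) hi
    obtain ⟨hj1, hj2, hj3⟩ := Nat.find_spec hex
    have hmin : ∀ k, k < Nat.find hex → ¬ _ := fun k hk => Nat.find_min hex hk
    set j := Nat.find hex
    rcases hj1.eq_or_lt with h | h
    · rw [← h] at hj3
      exact hj3
    exfalso
    have hnb : ∀ a, i + 1 ≤ a → ∀ k, a ≤ k → k + 2 ≤ j + 1 → f k ≠ f (k + 2) :=
      fun a ha k hk1 hk2 hk3 => hmin k (by omega) ⟨by omega, by omega, hk3⟩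
    have h1 := hdist (i + 1) (j + 1) (by omega) (by omega) (hnb (i + 1) le_rfl)
    have h2 := hdist (i + 2) (j + 1) (by omega) (by omega) (hnb (i + 2) (by omega))
    rcases hheavy _ _ _ _ (hne i (by omega)) (hne j (by omega)) (hback i (by omega) hbi)
      (hback j (by omega) hj3) with ⟨-, h⟩ | ⟨h, -⟩
    · exact h1 h
    · exact h2 (hbi.symm.trans h)
  obtain ⟨a, -, ha2, ha⟩ := hwin 0 (by omega)
  have hrun : ∀ k ≤ S, f (a + k) = f (a + k + 2) := by
    intro k
    induction k with
    | zero => exact fun _ => ha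
    | succ k ih => exact fun hk => hnext (a + k) (by omega) (ih (by omega))
  have halt : ∀ k ≤ S, f (a + k) = if Even k then f a else f (a + 1) := by
    intro k
    induction k using Nat.strong_induction_on with
    | _ k ih =>
      intro hk
      match k with
      | 0 => simp
      | 1 => simp
      | k + 2 =>
        rw [← add_assoc, ← hrun k (by omega), ih k (by omega) (by omega)]
        simp [Nat.even_add]
  have hna := hne a (by omega)
  have hm := hMS (f a) (f (a + 1))
  exact not_isRigid_of_getD (d := d) a hna (hfin _ _ hna) (by omega)
    (fun j hj => halt j (by omega)) hω

/-- One step of a point bouncing between the two ends of `{0, …, n}`; the Boolean is the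
direction of motion. -/
def bounceStep (n : ℕ) : ℕ × Bool → ℕ × Bool
  | (k, true) => if k < n then (k + 1, true) else (k - 1, false)
  | (k, false) => if 0 < k then (k - 1, false) else (k + 1, true)

/-- The trajectory of a point bouncing between the two ends of `{0, …, n}`. -/
def bounce (n : ℕ) : ℕ → ℕ × Bool
  | 0 => (0, true)
  | i + 1 => bounceStep n (bounce n i)

theorem bounce_le {n : ℕ} (hn : 2 ≤ n) (i : ℕ) : (bounce n i).1 ≤ n := by
  induction i with
  | zero => simp [bounce]
  | succ i ih =>
    rw [bounce]
    generalize bounce n i = q at ih ⊢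
    obtain ⟨k, b⟩ := q
    cases b <;> simp only [bounceStep] <;> split_ifs <;> simp only at ih ⊢ <;> omega

theorem bounce_steps {n : ℕ} (hn : 2 ≤ n) (i : ℕ) :
    ((bounce n (i + 1)).1 = (bounce n i).1 + 1 ∨ (bounce n i).1 = (bounce n (i + 1)).1 + 1) ∧
    ((bounce n (i + 2)).1 = (bounce n i).1 + 2 ∨ (bounce n i).1 = (bounce n (i + 2)).1 + 2 ∨
      ((bounce n i).1 = 1 ∧ (bounce n (i + 1)).1 = 0 ∧ (bounce n (i + 3)).1 = 2) ∨
      ((bounce n i).1 = n - 1 ∧ (bounce n (i + 1)).1 = n ∧ (bounce n (i + 3)).1 = n - 2)) := by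
  have h := bounce_le hn i
  simp only [bounce]
  generalize bounce n i = q at h ⊢
  obtain ⟨k, b⟩ := q
  simp only at h
  cases b <;> simp only [bounceStep]
  · rcases Nat.lt_or_ge 1 k with hk | hk
    · have h1 : 0 < k := by omega
      have h2 : 0 < k - 1 := by omega
      simp only [h1, h2, if_true]
      omega
    · interval_cases k
      · simp [show 1 < n by omega]
      · simp [show 1 < n by omega]
  · rcases Nat.lt_or_ge (k + 1) n with hk | hk
    · have h1 : k < n := by omega
      simp only [h1, hk, if_true]
      exact ⟨Or.inl trivial, Or.inl trivial⟩
    · rcases Nat.lt_or_ge k n with hk' | hk'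
      · obtain rfl : n = k + 1 := by omega
        simp [show 0 < k by omega]
      · obtain rfl : n = k := by omega
        simp [show 0 < n - 1 by omega]
        omega

/-- Two distinct heavy edges of a connected diagram are joined by a walk without
backtracking. -/
theorem exists_nonbacktracking (hconn : (diagram M).Connected) {s t u v : B}
    (hst : s ≠ t) (huv : u ≠ v) (h1 : 3 < M s t) (h2 : 3 < M u v) (hne : s(s, t) ≠ s(u, v)) :
    ∃ (n : ℕ) (x : ℕ → B), 2 ≤ n ∧ (∀ i < n, (diagram M).Adj (x i) (x (i + 1))) ∧
      (∀ i, i + 2 ≤ n → x i ≠ x (i + 2)) ∧ 3 < M (x 0) (x 1) ∧ 3 < M (x (n - 1)) (x n) := by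
  classical
  have hex : ∃ (n : ℕ) (x : ℕ → B), 2 ≤ n ∧ (∀ i < n, (diagram M).Adj (x i) (x (i + 1))) ∧
      s(x 0, x 1) = s(s, t) ∧ s(x (n - 1), x n) = s(u, v) := by
    obtain ⟨p⟩ := hconn.preconnected t u
    have hs : (diagram M).Adj s t := diagram_adj.2 ⟨hst, Or.inr h1.le⟩
    have hu : (diagram M).Adj u v := diagram_adj.2 ⟨huv, Or.inr h2.le⟩
    set q := SimpleGraph.Walk.cons hs (p.concat hu) with hq
    have hlen : q.length = p.length + 2 := by simp [hq]
    refine ⟨p.length + 2, q.getVert, by omega, fun i hi => q.adj_getVert_succ (by omega), ?_, ?_⟩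
    · simp [hq]
    · have e1 : q.getVert (p.length + 2) = v := by rw [← hlen, q.getVert_length]
      have e2 : q.getVert (p.length + 1) = u := by
        rw [hq, SimpleGraph.Walk.getVert_cons_succ, SimpleGraph.Walk.concat_eq_append,
          SimpleGraph.Walk.getVert_append]
        simp
      simp [e1, e2]
  obtain ⟨x, hn, hadj, hx0, hxn⟩ := Nat.find_spec hex
  have hmin : ∀ m, m < Nat.find hex → ¬ _ := fun m hm => Nat.find_min hex hm
  set n := Nat.find hex
  have weight : ∀ a b c d : B, s(a, b) = s(c, d) → M a b = M c d := by
    intro a b c d h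
    rcases Sym2.eq_iff.1 h with ⟨rfl, rfl⟩ | ⟨rfl, rfl⟩
    exacts [rfl, M.symmetric _ _]
  refine ⟨n, x, hn, hadj, fun i hi heq => ?_, by rwa [weight _ _ _ _ hx0],
    by rwa [weight _ _ _ _ hxn]⟩
  obtain ⟨m, hm⟩ : ∃ m, n = m + 2 := ⟨n - 2, by omega⟩
  rw [hm] at hxn hi hadj
  simp only [Nat.add_succ_sub_one] at hxn
  -- A shorter walk must have a single edge, which contradicts the two edges being distinct.
  rcases Nat.eq_zero_or_pos i with rfl | hi0
  · have hx1 : s(x 1, x 2) = s(s, t) := by rw [← hx0, ← heq, Sym2.eq_swap]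
    rcases Nat.eq_zero_or_pos m with rfl | hm0
    · exact hne (hx1.symm.trans hxn)
    · refine hmin (m + 1) (by omega) ⟨fun j => x (j + 1), by omega,
        fun j hj => hadj (j + 1) (by omega), hx1, ?_⟩
      simpa [Nat.sub_add_cancel hm0] using hxn
  rcases hi.eq_or_lt with hi' | hi'
  · obtain rfl : i = m := by omega
    refine hmin (i + 1) (by omega) ⟨x, by omega, fun j hj => hadj j (by omega), hx0, ?_⟩
    rw [← hxn, ← heq, Nat.add_sub_cancel, Sym2.eq_swap]
  · refine hmin m (by omega) ⟨fun j => if j ≤ i then x j else x (j + 2), by omega, ?_, ?_, ?_⟩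
    · intro j hj
      rcases lt_trichotomy j i with h | h | h
      · simpa [h.le, Nat.succ_le_of_lt h] using hadj j (by omega)
      · subst h
        simp only [le_refl, if_true, show ¬ j + 1 ≤ j by omega, if_false]
        rw [heq]
        exact hadj (j + 2) (by omega)
      · simp only [show ¬ j ≤ i by omega, show ¬ j + 1 ≤ i by omega, if_false]
        exact hadj (j + 2) (by omega)
    · simpa [Nat.succ_le_of_lt hi0] using hx0
    · simp only [show ¬ m ≤ i by omega, if_false]
      rcases Nat.lt_or_ge i (m - 1) with h | h
      · simp only [show ¬ m - 1 ≤ i by omega, if_false]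
        rwa [show m - 1 + 2 = m + 1 by omega]
      · obtain rfl : i = m - 1 := by omega
        simp only [le_refl, if_true]
        rw [heq]
        rwa [show m - 1 + 2 = m + 1 by omega]

theorem isAcyclic_of_finite [Finite B] (hconn : (diagram M).Connected) {s : B}
    (hs : (gammaSet cs s).Finite) : (diagram M).IsAcyclic := by
  intro v c hc
  have h3 := hc.three_le_length
  have hpos : 0 < c.length := by omega
  have hsucc : ∀ i, c.getVert ((i + 1) % c.length) = c.getVert (i % c.length + 1) := by
    intro i
    have hlt := Nat.mod_lt i hpos
    rw [Nat.add_mod, Nat.mod_eq_of_lt (show 1 < c.length by omega)]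
    rcases Nat.lt_or_ge (i % c.length + 1) c.length with h | h
    · rw [Nat.mod_eq_of_lt h]
    · rw [show i % c.length + 1 = c.length by omega, Nat.mod_self, c.getVert_zero,
        c.getVert_length]
  refine gammaSet_infinite_of_seq cs hconn (f := fun i => c.getVert (i % c.length)) ?_ ?_ s hs
  · intro i
    simp only [hsucc]
    exact c.adj_getVert_succ (Nat.mod_lt i hpos)
  · intro i hi
    exfalso
    have h1 := Nat.mod_lt i hpos
    have h2 := Nat.mod_lt (i + 2) hpos
    have := hc.getVert_injOn' (x₁ := i % c.length) (x₂ := (i + 2) % c.length)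
      (by simp only [Set.mem_ofPred_eq]; omega) (by simp only [Set.mem_ofPred_eq]; omega) hi
    have hmod : (0 + i) ≡ (2 + i) [MOD c.length] := by
      rw [zero_add, add_comm 2 i]; exact this
    have := Nat.ModEq.add_right_cancel' i hmod
    rw [Nat.ModEq, Nat.zero_mod, Nat.mod_eq_of_lt (by omega)] at this
    omega

theorem weight_ne_zero_of_finite [Finite B] (hconn : (diagram M).Connected) {r : B}
    (hr : (gammaSet cs r).Finite) {s t : B} (hst : s ≠ t) : M s t ≠ 0 := by
  intro h0
  have h0' : M t s = 0 := by rwa [M.symmetric]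
  refine gammaSet_infinite_of_seq cs hconn (f := fun i => if Even i then s else t) ?_ ?_ r hr
  · intro i
    rw [diagram_adj]
    simp only [Nat.even_add_one]
    split_ifs
    exacts [⟨hst, Or.inl h0⟩, ⟨hst.symm, Or.inl h0'⟩]
  · intro i _
    left
    simp only [Nat.even_add_one]
    split_ifs
    exacts [h0, h0']

theorem heavy_unique_of_finite [Finite B] (hconn : (diagram M).Connected) {r : B}
    (hr : (gammaSet cs r).Finite) {s t u v : B} (hst : s ≠ t) (huv : u ≠ v)
    (h1 : 3 < M s t) (h2 : 3 < M u v) : (s = u ∧ t = v) ∨ (s = v ∧ t = u) := by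
  rw [← Sym2.eq_iff]
  by_contra hne
  obtain ⟨n, x, hn, hadj, hback, hx0, hxn⟩ := exists_nonbacktracking hconn hst huv h1 h2 hne
  refine gammaSet_infinite_of_seq cs hconn (f := fun i => x (bounce n i).1) ?_ ?_ r hr
  · intro i
    have hi := bounce_le hn i
    have hi' := bounce_le hn (i + 1)
    rcases (bounce_steps hn i).1 with h | h
    · simp only [h]
      exact hadj _ (by omega)
    · simp only [h]
      exact (hadj _ (by omega)).symm
  · intro i heq
    right
    have hi := bounce_le hn i
    have hi' := bounce_le hn (i + 2)
    rcases (bounce_steps hn i).2 with h | h | ⟨a, b, c⟩ | ⟨a, b, c⟩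
    · rw [h] at heq hi'
      exact absurd heq (hback _ hi')
    · rw [h] at heq hi
      exact absurd heq.symm (hback _ hi)
    · simp only [a, b, c]
      exact ⟨by rwa [M.symmetric], hback 0 hn⟩
    · simp only [a, b, c]
      have := hback (n - 2) (by omega)
      rw [Nat.sub_add_cancel hn] at this
      exact ⟨hxn, this.symm⟩

theorem isTree_of_finite [Finite B] (hconn : (diagram M).Connected) {r : B}
    (hr : (gammaSet cs r).Finite) :
    (diagram M).IsTree ∧ (∀ s t : B, s ≠ t → M s t ≠ 0) ∧
      (∀ s t u v : B, s ≠ t → u ≠ v →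
        (M s t = 0 ∨ 3 < M s t) → (M u v = 0 ∨ 3 < M u v) →
        ((s = u ∧ t = v) ∨ (s = v ∧ t = u))) := by
  have h0 := fun (s t : B) (hst : s ≠ t) => weight_ne_zero_of_finite cs hconn hr hst
  exact ⟨⟨hconn, isAcyclic_of_finite cs hconn hr⟩, h0,
    fun s t u v hst huv h1 h2 => heavy_unique_of_finite cs hconn hr hst huv
      (h1.resolve_left (h0 s t hst)) (h2.resolve_left (h0 u v huv))⟩

theorem finite_of_isTree [Finite B]
    (h : (diagram M).IsTree ∧ (∀ s t : B, s ≠ t → M s t ≠ 0) ∧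
      (∀ s t u v : B, s ≠ t → u ≠ v →
        (M s t = 0 ∨ 3 < M s t) → (M u v = 0 ∨ 3 < M u v) →
        ((s = u ∧ t = v) ∨ (s = v ∧ t = u)))) (r : B) : (gammaSet cs r).Finite := by
  obtain ⟨htree, h0, hheavy⟩ := h
  obtain ⟨_, hK⟩ := exists_bound_of_tree htree.isAcyclic h0
    fun s t u v hst huv h1 h2 => hheavy s t u v hst huv (Or.inr h1) (Or.inr h2)
  exact gammaSet_finite_of_bounded cs hK r

end Subregular

/-- For an irreducible Coxeter system with `S` finite (i.e. the Coxeter diagram, with an edge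
`{s,t}` whenever `m(s,t) ≥ 3` — including `m(s,t) = ∞`, encoded as `0` — is connected), the
following are equivalent: (i) `Γ_s ∩ Γ_s⁻¹` is finite for some `s`; (ii) `Γ_s ∩ Γ_s⁻¹` is
finite for every `s`; (iii) the diagram is a tree, no edge has weight `∞`, and at most one
edge has weight greater than `3`. -/
theorem gammaSet_finite_tfae {M : CoxeterMatrix B} (cs : CoxeterSystem M W) [Fintype B]
    (hconn : (SimpleGraph.fromRel (fun s t : B => M s t = 0 ∨ 3 ≤ M s t)).Connected) :
    ((∃ s : B, (gammaSet cs s).Finite) ↔ (∀ s : B, (gammaSet cs s).Finite)) ∧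
    ((∃ s : B, (gammaSet cs s).Finite) ↔
      ((SimpleGraph.fromRel (fun s t : B => M s t = 0 ∨ 3 ≤ M s t)).IsTree ∧
        (∀ s t : B, s ≠ t → M s t ≠ 0) ∧
        (∀ s t u v : B, s ≠ t → u ≠ v →
          (M s t = 0 ∨ 3 < M s t) → (M u v = 0 ∨ 3 < M u v) →
          ((s = u ∧ t = v) ∨ (s = v ∧ t = u))))) := by
  have tree : (∃ s : B, (gammaSet cs s).Finite) → _ := fun ⟨_, hr⟩ =>
    Subregular.isTree_of_finite cs hconn hr
  have all_some : (∀ s : B, (gammaSet cs s).Finite) → ∃ s : B, (gammaSet cs s).Finite :=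
    fun h => hconn.nonempty.elim fun s => ⟨s, h s⟩
  have all : _ → ∀ s : B, (gammaSet cs s).Finite := Subregular.finite_of_isTree cs
  exact ⟨⟨fun h => all (tree h), all_some⟩, tree, fun h => all_some (all h)⟩
end
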